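/- arXiv:1612.06473 — 2 statements merged into one kernel-verified Lean document; each statement's English description precedes it below -/
import Mathlib

section
/- The sorting number of the star graph K_{1,n-1} is Θ(n log n): there is a sorting network on the star of depth O(n log n), and every sorting network on the star has depth Ω(n log n). -/
open Finset

variable {V : Type*}

/-- A stage of a sorting network on a graph `G`: a finite set of vertex-disjoint
edges of `G`, each either directed (compare-exchange) or undirected (swap). -/
structure Stage {V : Type*} (G : SimpleGraph V) where
  pairs : Finset (V × V)
  adj : ∀ p ∈ pairs, G.Adj p.1 p.2
  directed : V × V → Bool
  disj : ∀ p ∈ pairs, ∀ q ∈ pairs, p ≠ q →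
    p.1 ≠ q.1 ∧ p.1 ≠ q.2 ∧ p.2 ≠ q.1 ∧ p.2 ≠ q.2

open scoped Classical in
/-- Apply a stage to a configuration of keys `f : V → ℕ`.  For a directed pair
`(u,v)` the smaller key goes to `u` and the larger to `v`; an undirected pair
unconditionally swaps its keys. -/
noncomputable def Stage.apply {G : SimpleGraph V} (s : Stage G) (f : V → ℕ) (v : V) : ℕ :=
  if h1 : ∃ p, p ∈ s.pairs ∧ p.1 = v then
    (if s.directed h1.choose then min (f h1.choose.1) (f h1.choose.2) else f h1.choose.2)
  else if h2 : ∃ p, p ∈ s.pairs ∧ p.2 = v then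
    (if s.directed h2.choose then max (f h2.choose.1) (f h2.choose.2) else f h2.choose.1)
  else f v

noncomputable def runNetwork {G : SimpleGraph V} (L : List (Stage G)) (f : V → ℕ) : V → ℕ :=
  L.foldl (fun g s => s.apply g) f

/-- `L` is a sorting network on `(G, π)`: for every injective assignment of keys,
after running all stages, the key at a vertex of smaller `π`-rank is smaller. -/
def IsSortingNetwork {n : ℕ} (G : SimpleGraph V) (π : V ≃ Fin n) (L : List (Stage G)) : Prop :=
  ∀ f : V → ℕ, Function.Injective f →
    ∀ u w : V, π u < π w → runNetwork L f u < runNetwork L f w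

/-- Minimal depth of a sorting network on `(G, π)`. -/
noncomputable def stP {n : ℕ} (G : SimpleGraph V) (π : V ≃ Fin n) : ℕ :=
  sInf {t | ∃ L : List (Stage G), L.length = t ∧ IsSortingNetwork G π L}

/-- The sorting number of `G` : the minimum over sorted orders `π` of the
minimal depth of a sorting network on `(G, π)`. -/
noncomputable def st [Fintype V] (G : SimpleGraph V) : ℕ :=
  sInf {t | ∃ π : V ≃ Fin (Fintype.card V), ∃ L : List (Stage G),
    L.length = t ∧ IsSortingNetwork G π L}

/-- A matching step: an involution of the vertices moving pebbles only along edges. -/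
def IsMatchingStep (G : SimpleGraph V) (σ : Equiv.Perm V) : Prop :=
  (∀ v, σ (σ v) = v) ∧ ∀ v, σ v ≠ v → G.Adj v (σ v)

/-- Position of a pebble starting at `v` after applying the matching steps in `L`. -/
def finalPos (L : List (Equiv.Perm V)) (v : V) : V :=
  L.foldl (fun p σ => σ p) v

/-- `t` matching steps of `G` suffice to route every pebble from `v` to `σ v`. -/
def RoutesIn (G : SimpleGraph V) (σ : Equiv.Perm V) (t : ℕ) : Prop :=
  ∃ L : List (Equiv.Perm V), L.length = t ∧ (∀ τ ∈ L, IsMatchingStep G τ) ∧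
    ∀ v, finalPos L v = σ v

/-- Routing time of the permutation `σ` on `G`. -/
noncomputable def rtP (G : SimpleGraph V) (σ : Equiv.Perm V) : ℕ :=
  sInf {t | RoutesIn G σ t}

/-- The routing number of `G`. -/
noncomputable def rt [Fintype V] [DecidableEq V] (G : SimpleGraph V) : ℕ :=
  Finset.univ.sup fun σ : Equiv.Perm V => rtP G σ

/-- The star graph `K_{1,n-1}`: the vertex `0` is the center, adjacent to all
other vertices, and there are no other edges. -/
def starGraph (n : ℕ) : SimpleGraph (Fin n) :=
  SimpleGraph.fromRel (fun u _ => u.val = 0)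

namespace SN

/-- compare-exchange -/
def cx {α : Type*} [LinearOrder α] (c : ℕ × ℕ) (f : ℕ → α) : ℕ → α := fun v =>
  if v = c.1 then min (f c.1) (f c.2) else if v = c.2 then max (f c.1) (f c.2) else f v

def run {α : Type*} [LinearOrder α] (L : List (ℕ × ℕ)) (f : ℕ → α) : ℕ → α :=
  L.foldl (fun g c => cx c g) f

@[simp] theorem run_nil {α : Type*} [LinearOrder α] (f : ℕ → α) : run [] f = f := rfl
@[simp] theorem run_cons {α : Type*} [LinearOrder α] (c : ℕ × ℕ) (L) (f : ℕ → α) :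
    run (c :: L) f = run L (cx c f) := rfl
theorem run_append {α : Type*} [LinearOrder α] (L M : List (ℕ × ℕ)) (f : ℕ → α) :
    run (L ++ M) f = run M (run L f) := by simp [run, List.foldl_append]

/-- standard network on `n` wires -/
def Std (n : ℕ) (L : List (ℕ × ℕ)) : Prop := ∀ c ∈ L, c.1 < c.2 ∧ c.2 < n

theorem Std.append {n} {L M : List (ℕ × ℕ)} (h : Std n L) (h' : Std n M) : Std n (L ++ M) := by
  intro c hc
  rcases List.mem_append.1 hc with hc | hc
  · exact h c hc
  · exact h' c hc

theorem Std.flatMap {ι} {n} {l : List ι} {F : ι → List (ℕ × ℕ)} (h : ∀ i ∈ l, Std n (F i)) :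
    Std n (l.flatMap F) := by
  intro c hc
  obtain ⟨i, hi, hc⟩ := List.mem_flatMap.1 hc
  exact h i hi c hc

theorem run_untouched {α : Type*} [LinearOrder α] (L : List (ℕ × ℕ)) (f : ℕ → α) (v : ℕ)
    (h : ∀ c ∈ L, v ≠ c.1 ∧ v ≠ c.2) : run L f v = f v := by
  induction L generalizing f with
  | nil => rfl
  | cons c L ih =>
    rw [run_cons, ih _ (fun c hc => h c (List.mem_cons_of_mem _ hc))]
    have := h c (by simp)
    simp [cx, this.1, this.2]

theorem run_left_le {α : Type*} [LinearOrder α] (A : ℕ → Prop) (L : List (ℕ × ℕ)) (f : ℕ → α)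
    (h : ∀ c ∈ L, A c.1 ∧ ¬ A c.2) (v : ℕ) :
    (A v → run L f v ≤ f v) ∧ (¬ A v → f v ≤ run L f v) := by
  induction L generalizing f with
  | nil => simp
  | cons c L ih =>
    have h1 := ih (cx c f) (fun c hc => h c (List.mem_cons_of_mem _ hc))
    obtain ⟨ha, hb⟩ := h c (by simp)
    rw [run_cons]
    constructor
    · intro hv
      refine (h1.1 hv).trans ?_
      have : v ≠ c.2 := by rintro rfl; exact hb hv
      unfold cx; split_ifs with e
      · subst e; exact min_le_left _ _
      · exact le_rfl
    · intro hv
      refine le_trans ?_ (h1.2 hv)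
      have : v ≠ c.1 := by rintro rfl; exact hv ha
      unfold cx; rw [if_neg this]; split_ifs with e
      · subst e; exact le_max_right _ _
      · exact le_rfl

theorem run_layer {α : Type*} [LinearOrder α] (A : ℕ → Prop) (L : List (ℕ × ℕ)) (f : ℕ → α)
    (h : ∀ c ∈ L, A c.1 ∧ ¬ A c.2) : ∀ c ∈ L, run L f c.1 ≤ run L f c.2 := by
  induction L generalizing f with
  | nil => simp
  | cons c L ih =>
    have hL : ∀ c ∈ L, A c.1 ∧ ¬ A c.2 := fun c hc => h c (List.mem_cons_of_mem _ hc)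
    intro d hd
    rcases List.mem_cons.1 hd with rfl | hd
    · obtain ⟨ha, hb⟩ := h d (by simp)
      rw [run_cons]
      refine ((run_left_le A L _ hL d.1).1 ha).trans (le_trans ?_ ((run_left_le A L _ hL d.2).2 hb))
      have : d.2 ≠ d.1 := by intro e; rw [e] at hb; exact hb ha
      simp [cx, this]
    · exact ih _ hL d hd

/-- number of ones in a set -/
def on (f : ℕ → Bool) (S : Finset ℕ) : ℕ := (S.filter (fun v => f v = true)).card

theorem cx_cases (c : ℕ × ℕ) (_hc : c.1 < c.2) (f : ℕ → Bool) :
    cx c f = f ∨ (f c.1 = true ∧ f c.2 = false ∧ ∀ v, cx c f v = f (Equiv.swap c.1 c.2 v)) := by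
  rcases h1 : f c.1 with _ | _ <;> rcases h2 : f c.2 with _ | _
  · left; funext v; unfold cx; split_ifs with a b <;> simp_all
  · left; funext v; unfold cx; split_ifs with a b <;> simp_all
  · right; refine ⟨rfl, rfl, fun v => ?_⟩
    unfold cx; split_ifs with a b
    · subst a; simp [h1, h2]
    · subst b; simp [h1, h2]
    · rw [Equiv.swap_apply_of_ne_of_ne a b]
  · left; funext v; unfold cx; split_ifs with a b <;> simp_all

theorem on_cx_le (c : ℕ × ℕ) (hc : c.1 < c.2) (f : ℕ → Bool) (S : Finset ℕ)
    (h : c.2 ∈ S → c.1 ∈ S) : on (cx c f) S ≤ on f S := by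
  rcases cx_cases c hc f with e | ⟨h1, h2, h3⟩
  · rw [e]
  · unfold on
    refine Finset.card_le_card_of_injOn (Equiv.swap c.1 c.2) ?_ (Equiv.injective _).injOn
    intro v hv
    simp only [Finset.coe_filter, Set.mem_ofPred_eq, h3] at hv ⊢
    refine ⟨?_, hv.2⟩
    by_cases a : v = c.1
    · subst a; simp [h2] at hv
    by_cases b : v = c.2
    · subst b; rw [Equiv.swap_apply_right]; exact h hv.1
    rw [Equiv.swap_apply_of_ne_of_ne a b]; exact hv.1

theorem le_on_cx (c : ℕ × ℕ) (hc : c.1 < c.2) (f : ℕ → Bool) (S : Finset ℕ)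
    (h : c.1 ∈ S → c.2 ∈ S) : on f S ≤ on (cx c f) S := by
  rcases cx_cases c hc f with e | ⟨h1, h2, h3⟩
  · rw [e]
  · unfold on
    refine Finset.card_le_card_of_injOn (Equiv.swap c.1 c.2) ?_ (Equiv.injective _).injOn
    intro v hv
    simp only [Finset.coe_filter, Set.mem_ofPred_eq, h3, Equiv.swap_apply_self] at hv ⊢
    refine ⟨?_, hv.2⟩
    by_cases a : v = c.1
    · subst a; rw [Equiv.swap_apply_left]; exact h hv.1
    by_cases b : v = c.2
    · subst b; simp [h2] at hv
    rw [Equiv.swap_apply_of_ne_of_ne a b]; exact hv.1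

theorem on_run_le (L : List (ℕ × ℕ)) (f : ℕ → Bool) (S : Finset ℕ)
    (hL : ∀ c ∈ L, c.1 < c.2) (h : ∀ c ∈ L, c.2 ∈ S → c.1 ∈ S) : on (run L f) S ≤ on f S := by
  induction L generalizing f with
  | nil => simp
  | cons c L ih =>
    rw [run_cons]
    exact (ih _ (fun c hc => hL c (List.mem_cons_of_mem _ hc))
      (fun c hc => h c (List.mem_cons_of_mem _ hc))).trans
      (on_cx_le c (hL c (by simp)) f S (h c (by simp)))

theorem le_on_run (L : List (ℕ × ℕ)) (f : ℕ → Bool) (S : Finset ℕ)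
    (hL : ∀ c ∈ L, c.1 < c.2) (h : ∀ c ∈ L, c.1 ∈ S → c.2 ∈ S) : on f S ≤ on (run L f) S := by
  induction L generalizing f with
  | nil => simp
  | cons c L ih =>
    rw [run_cons]
    exact (le_on_cx c (hL c (by simp)) f S (h c (by simp))).trans
      (ih _ (fun c hc => hL c (List.mem_cons_of_mem _ hc))
      (fun c hc => h c (List.mem_cons_of_mem _ hc)))

/-- ones in `[a,c)` -/
def cnt (f : ℕ → Bool) (a c : ℕ) : ℕ := on f (Finset.Ico a c)
/-- zeros in `[a,c)` -/
def cnz (f : ℕ → Bool) (a c : ℕ) : ℕ := cnt (fun v => !f v) a c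

theorem cnt_add (f : ℕ → Bool) {a b c : ℕ} (h : a ≤ b) (h' : b ≤ c) :
    cnt f a b + cnt f b c = cnt f a c := by
  unfold cnt on
  rw [← Finset.Ico_union_Ico_eq_Ico h h', Finset.filter_union, Finset.card_union_of_disjoint]
  exact Finset.disjoint_filter_filter (Finset.Ico_disjoint_Ico_consecutive a b c)

theorem cnz_add (f : ℕ → Bool) {a b c : ℕ} (h : a ≤ b) (h' : b ≤ c) :
    cnz f a b + cnz f b c = cnz f a c := cnt_add _ h h'

@[simp] theorem cnt_self (f : ℕ → Bool) (a : ℕ) : cnt f a a = 0 := by simp [cnt, on]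
@[simp] theorem cnz_self (f : ℕ → Bool) (a : ℕ) : cnz f a a = 0 := by simp [cnz]

theorem cnt_mono (f : ℕ → Bool) {a b a' b' : ℕ} (h : a' ≤ a) (h' : b ≤ b') :
    cnt f a b ≤ cnt f a' b' :=
  Finset.card_le_card (Finset.filter_subset_filter _ (Finset.Ico_subset_Ico h h'))
theorem cnz_mono (f : ℕ → Bool) {a b a' b' : ℕ} (h : a' ≤ a) (h' : b ≤ b') :
    cnz f a b ≤ cnz f a' b' := cnt_mono _ h h'

theorem cnt_congr {f g : ℕ → Bool} {a b : ℕ} (h : ∀ v, a ≤ v → v < b → f v = g v) :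
    cnt f a b = cnt g a b := by
  unfold cnt on
  congr 1
  apply Finset.filter_congr
  intro v hv
  rw [Finset.mem_Ico] at hv
  rw [h v hv.1 hv.2]

theorem cnt_add_cnz (f : ℕ → Bool) (a c : ℕ) : cnt f a c + cnz f a c = c - a := by
  unfold cnz cnt on
  have := Finset.card_filter_add_card_filter_not (s := Finset.Ico a c) (fun v => f v = true)
  simpa using this

theorem cnt_run_front (L : List (ℕ × ℕ)) (f : ℕ → Bool) (x : ℕ) (hL : ∀ c ∈ L, c.1 < c.2) :
    cnt (run L f) 0 x ≤ cnt f 0 x := by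
  apply on_run_le L f _ hL
  intro c hc h
  have := hL c hc
  simp at h ⊢; omega

theorem cnt_run_eq (L : List (ℕ × ℕ)) (f : ℕ → Bool) (a b : ℕ)
    (hL : ∀ c ∈ L, c.1 < c.2) (h : ∀ c ∈ L, (a ≤ c.1 ∧ c.1 < b) ↔ (a ≤ c.2 ∧ c.2 < b)) :
    cnt (run L f) a b = cnt f a b := by
  apply le_antisymm
  · apply on_run_le L f _ hL
    intro c hc; have := h c hc; simp; omega
  · apply le_on_run L f _ hL
    intro c hc; have := h c hc; simp; omega

theorem cnz_run_eq (L : List (ℕ × ℕ)) (f : ℕ → Bool) (a b : ℕ)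
    (hL : ∀ c ∈ L, c.1 < c.2) (h : ∀ c ∈ L, (a ≤ c.1 ∧ c.1 < b) ↔ (a ≤ c.2 ∧ c.2 < b)) :
    cnz (run L f) a b = cnz f a b := by
  have := cnt_run_eq L f a b hL h
  have := cnt_add_cnz f a b
  have := cnt_add_cnz (run L f) a b
  omega

theorem cnz_run_total {n : ℕ} (L : List (ℕ × ℕ)) (f : ℕ → Bool) (hL : Std n L) :
    cnz (run L f) 0 n = cnz f 0 n := by
  apply cnz_run_eq L f 0 n (fun c hc => (hL c hc).1)
  intro c hc; have := hL c hc; omega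

/-- balance identity -/
theorem balance (f : ℕ → Bool) {n x : ℕ} (hx : x ≤ n) :
    cnt f 0 x + cnz f 0 n = cnz f x n + x := by
  have h1 := cnz_add f (Nat.zero_le x) hx
  have h2 := cnt_add_cnz f 0 x
  omega

theorem cnz_run_suffix {n : ℕ} (L : List (ℕ × ℕ)) (f : ℕ → Bool) (x : ℕ) (hL : Std n L) :
    cnz (run L f) x n ≤ cnz f x n := by
  rcases le_total x n with hx | hx
  · have h1 := balance f hx
    have h2 := balance (run L f) hx
    have h3 := cnz_run_total L f hL
    have h4 := cnt_run_front L f x (fun c hc => (hL c hc).1)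
    omega
  · have h2 := cnt_add_cnz (run L f) x n
    omega

theorem cnt_blocks (f : ℕ → Bool) (b a X : ℕ) (h : a ≤ X) :
    cnt f 0 (X * b) = cnt f 0 (a * b) + ∑ i ∈ Finset.Ico a X, cnt f (i * b) ((i + 1) * b) := by
  induction X, h using Nat.le_induction with
  | base => simp
  | succ X h ih =>
    rw [Finset.sum_Ico_succ_top h, ← add_assoc, ← ih]
    rw [cnt_add f (Nat.zero_le _) (Nat.mul_le_mul_right _ (Nat.le_succ X))]

end SN

namespace SN
theorem pow_self_le (t : ℕ) : ((t : ℝ)) ^ t ≤ 4 ^ t * (t.factorial : ℝ) := by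
  have h := Real.pow_div_factorial_le_exp (t : ℝ) (by positivity) t
  have h2 : Real.exp (t : ℝ) ≤ 4 ^ t := by
    rw [← Real.exp_one_pow]
    exact pow_le_pow_left₀ (Real.exp_pos _).le (by linarith [Real.exp_one_lt_d9]) t
  have h3 : (0 : ℝ) < t.factorial := by positivity
  rw [div_le_iff₀ h3] at h
  exact h.trans (by gcongr)

theorem choose_bound (N t : ℕ) : (N.choose t : ℝ) * (t : ℝ) ^ t ≤ 4 ^ t * (N : ℝ) ^ t := by
  have h := Nat.choose_le_pow_div (α := ℝ) t N
  have h3 : (0 : ℝ) < t.factorial := by positivity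
  rw [le_div_iff₀ h3] at h
  calc (N.choose t : ℝ) * (t : ℝ) ^ t ≤ N.choose t * (4 ^ t * (t.factorial : ℝ)) := by
        gcongr; exact pow_self_le t
    _ = 4 ^ t * (N.choose t * t.factorial) := by ring
    _ ≤ _ := by gcongr

/-- union bound -/
theorem exists_avoid (N d : ℕ) (hN : 0 < N) (B : Finset (Finset (Fin N) × Finset (Fin N)))
    (hB : ∑ p ∈ B, ((p.2.card : ℝ) / N) ^ (d * p.1.card) < 1) :
    ∃ g : Fin N × Fin d → Fin N, ∀ p ∈ B, ∃ s ∈ p.1, ∃ k, g (s, k) ∉ p.2 := by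
  classical
  by_contra hcon
  push Not at hcon
  have hNR : (0 : ℝ) < N := by exact_mod_cast hN
  let bad : Finset (Fin N) × Finset (Fin N) → Finset (Fin N × Fin d → Fin N) := fun p =>
    Fintype.piFinset (fun q => if q.1 ∈ p.1 then p.2 else Finset.univ)
  have hcov : (Finset.univ : Finset (Fin N × Fin d → Fin N)) ⊆ B.biUnion bad := by
    intro g _
    obtain ⟨p, hp, h⟩ := hcon g
    rw [Finset.mem_biUnion]
    refine ⟨p, hp, ?_⟩
    simp only [bad, Fintype.mem_piFinset]
    rintro ⟨s, k⟩
    by_cases hs : s ∈ p.1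
    · simpa [hs] using h s hs k
    · simp [hs]
  have hbad : ∀ p, ((bad p).card : ℝ) = ((p.2.card : ℝ) / N) ^ (d * p.1.card) * (N : ℝ) ^ (N * d) := by
    intro p
    simp only [bad, Fintype.card_piFinset]
    rw [Fintype.prod_prod_type]
    have : ∀ s : Fin N, (∏ k : Fin d, (if (s, k).1 ∈ p.1 then p.2 else (Finset.univ : Finset (Fin N))).card)
        = if s ∈ p.1 then p.2.card ^ d else N ^ d := by
      intro s
      by_cases hs : s ∈ p.1 <;> simp [hs]
    simp only [this]
    push_cast
    have h2 : ∀ s : Fin N, (if s ∈ p.1 then ((p.2.card : ℝ)) ^ d else (N : ℝ) ^ d)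
        = (if s ∈ p.1 then ((p.2.card : ℝ) / N) ^ d else 1) * (N : ℝ) ^ d := by
      intro s
      split_ifs
      · rw [div_pow]; field_simp
      · simp
    simp only [h2]
    rw [Finset.prod_mul_distrib, Finset.prod_ite_mem]
    simp [pow_mul]
    left; ring
  have h1 : (Finset.univ : Finset (Fin N × Fin d → Fin N)).card ≤ ∑ p ∈ B, (bad p).card :=
    (Finset.card_le_card hcov).trans Finset.card_biUnion_le
  have h2 : ((Finset.univ : Finset (Fin N × Fin d → Fin N)).card : ℝ) = (N : ℝ) ^ (N * d) := by
    simp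
  have h3 : (N : ℝ) ^ (N * d) ≤ ∑ p ∈ B, ((p.2.card : ℝ) / N) ^ (d * p.1.card) * (N : ℝ) ^ (N * d) := by
    rw [← h2]
    calc _ ≤ ((∑ p ∈ B, (bad p).card : ℕ) : ℝ) := by exact_mod_cast h1
      _ = _ := by push_cast; simp only [hbad]; rw [h2]
  rw [← Finset.sum_mul] at h3
  have h4 : (0 : ℝ) < (N : ℝ) ^ (N * d) := by positivity
  nlinarith

theorem term_bound (N lam s d : ℕ) (hl : 1 ≤ lam) (hs : 1 ≤ s) (h : 2 * (lam * s) ≤ N)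
    (hd : d = 4 * lam + 5) :
    (N.choose s : ℝ) * (N.choose (lam * s)) * (((lam * s : ℕ) : ℝ) / N) ^ (d * s) ≤ (1 / 4) ^ s := by
  have hN : 0 < N := by have : 0 < lam * s := by positivity
                        omega
  have hNR : (0 : ℝ) < N := by exact_mod_cast hN
  set t := lam * s with ht
  have ht0 : 0 < t := by positivity
  have htR : (0 : ℝ) < t := by exact_mod_cast ht0
  set y : ℝ := (t : ℝ) / N with hy
  have hy0 : 0 < y := by positivity
  have hy1 : y ≤ 1 / 2 := by
    rw [hy, div_le_iff₀ hNR]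
    have : (2 * t : ℝ) ≤ N := by exact_mod_cast h
    linarith
  have c1 : (N.choose t : ℝ) * y ^ t ≤ 4 ^ t := by
    rw [hy, div_pow, mul_div_assoc', div_le_iff₀ (by positivity)]
    exact choose_bound N t
  have c2 : (N.choose s : ℝ) * y ^ s ≤ (4 * lam) ^ s := by
    have : (y : ℝ) ^ s = lam ^ s * ((s : ℝ) ^ s / N ^ s) := by
      rw [hy, ht]; push_cast; rw [div_pow, mul_pow]; ring
    rw [this, mul_pow]
    have h2 : (N.choose s : ℝ) * ((s : ℝ) ^ s / N ^ s) ≤ 4 ^ s := by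
      rw [mul_div_assoc', div_le_iff₀ (by positivity)]
      exact choose_bound N s
    calc _ = (N.choose s : ℝ) * ((s : ℝ) ^ s / N ^ s) * lam ^ s := by ring
      _ ≤ _ := by gcongr
  have hlam : (lam : ℝ) ≤ 2 ^ lam := by exact_mod_cast Nat.lt_two_pow_self.le
  have e : d * s = s + t + (3 * lam + 4) * s := by rw [hd, ht]; ring
  rw [e, pow_add, pow_add]
  calc (N.choose s : ℝ) * (N.choose t) * (y ^ s * y ^ t * y ^ ((3 * lam + 4) * s))
      = (N.choose s * y ^ s) * (N.choose t * y ^ t) * y ^ ((3 * lam + 4) * s) := by ring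
    _ ≤ (4 * lam) ^ s * 4 ^ t * (1 / 2) ^ ((3 * lam + 4) * s) := by gcongr
    _ ≤ (4 * 2 ^ lam) ^ s * 4 ^ t * (1 / 2) ^ ((3 * lam + 4) * s) := by gcongr
    _ = ((4 * 2 ^ lam) * 4 ^ lam * (1 / 2) ^ (3 * lam + 4)) ^ s := by
        rw [ht, pow_mul, pow_mul, ← mul_pow, ← mul_pow]
    _ = (1 / 4) ^ s := by
        congr 1
        have : (4 : ℝ) ^ lam = 2 ^ lam * 2 ^ lam := by rw [← mul_pow]; norm_num
        rw [this, pow_add, pow_mul']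
        rw [show ((1 / 2 : ℝ) ^ lam) ^ 3 = 1 / (2 ^ lam) ^ 3 by rw [div_pow, div_pow, one_pow, one_pow]]
        field_simp
        norm_num

/-- edges from a function -/
def edgesOf (N d : ℕ) (g : Fin N × Fin d → Fin N) : List (ℕ × ℕ) :=
  (List.finRange N).flatMap fun s : Fin N => (List.finRange d).map fun k : Fin d => ((s : ℕ), (g (s, k) : ℕ))

theorem edgesOf_length (N d : ℕ) (g) : (edgesOf N d g).length = d * N := by
  simp [edgesOf, List.length_flatMap]; ring

theorem edgesOf_lt (N d : ℕ) (g) : ∀ e ∈ edgesOf N d g, e.1 < N ∧ e.2 < N := by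
  intro e he
  simp only [edgesOf, List.mem_flatMap, List.mem_map] at he
  obtain ⟨s, _, k, _, rfl⟩ := he
  exact ⟨s.2, (g _).2⟩

theorem mem_edgesOf (N d : ℕ) (g) (s : Fin N) (k : Fin d) :
    ((s : ℕ), (g (s, k) : ℕ)) ∈ edgesOf N d g := by
  simp only [edgesOf, List.mem_flatMap, List.mem_map]
  exact ⟨s, List.mem_finRange _, k, List.mem_finRange _, rfl⟩

theorem preimage_card (N : ℕ) (S : Finset ℕ) (hS : ∀ v ∈ S, v < N) :
    ((Finset.univ : Finset (Fin N)).filter (fun v : Fin N => (v : ℕ) ∈ S)).card = S.card := by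
  apply Finset.card_bij (fun (v : Fin N) _ => (v : ℕ))
  · intro a ha; simpa using ha
  · intro a _ b _ h; exact Fin.ext h
  · intro b hb; exact ⟨⟨b, hS b hb⟩, by simpa using hb, rfl⟩

theorem exists_expander (lam N : ℕ) (hl : 1 ≤ lam) :
    ∃ E : List (ℕ × ℕ), E.length ≤ 9 * lam * N ∧ (∀ e ∈ E, e.1 < N ∧ e.2 < N) ∧
      ∀ S T : Finset ℕ, (∀ v ∈ S, v < N) → (∀ v ∈ T, v < N) →
        (∀ e ∈ E, e.1 ∈ S → e.2 ∈ T) → 4 * T.card < N → lam * S.card ≤ T.card := by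
  classical
  rcases lt_or_ge N (4 * lam) with hN | hN
  · refine ⟨edgesOf N N (fun p => p.2), ?_, edgesOf_lt _ _ _, ?_⟩
    · rw [edgesOf_length]; exact Nat.mul_le_mul_right _ (by omega)
    · intro S T hS hT h hc
      rcases S.eq_empty_or_nonempty with rfl | ⟨s, hs⟩
      · simp
      · exfalso
        have : Finset.range N ⊆ T := by
          intro v hv
          exact h _ (mem_edgesOf N N (fun p => p.2) ⟨s, hS s hs⟩ ⟨v, Finset.mem_range.1 hv⟩) hs
        have := Finset.card_le_card this
        simp at this
        omega
  · have hN0 : 0 < N := by omega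
    set d := 4 * lam + 5 with hd
    let Bs : ℕ → Finset (Finset (Fin N) × Finset (Fin N)) := fun s =>
      Finset.powersetCard s Finset.univ ×ˢ Finset.powersetCard (lam * s) Finset.univ
    let R := (Finset.Icc 1 N).filter (fun s => 2 * (lam * s) ≤ N)
    obtain ⟨g, hg⟩ := exists_avoid N d hN0 (R.biUnion Bs) (by
      calc ∑ p ∈ R.biUnion Bs, ((p.2.card : ℝ) / N) ^ (d * p.1.card)
          = ∑ s ∈ R, ∑ p ∈ Bs s, ((p.2.card : ℝ) / N) ^ (d * p.1.card) := by
            apply Finset.sum_biUnion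
            intro s _ s' _ hss
            rw [Function.onFun, Finset.disjoint_left]
            intro p hp hp'
            simp only [Bs, Finset.mem_product, Finset.mem_powersetCard] at hp hp'
            exact hss (hp.1.2.symm.trans hp'.1.2)
        _ ≤ ∑ s ∈ R, (1 / 4 : ℝ) ^ s := by
            apply Finset.sum_le_sum
            intro s hs
            simp only [R, Finset.mem_filter, Finset.mem_Icc] at hs
            have : ∀ p ∈ Bs s, ((p.2.card : ℝ) / N) ^ (d * p.1.card)
                = (((lam * s : ℕ) : ℝ) / N) ^ (d * s) := by
              intro p hp
              simp only [Bs, Finset.mem_product, Finset.mem_powersetCard] at hp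
              rw [hp.1.2, hp.2.2]
            rw [Finset.sum_congr rfl this, Finset.sum_const, nsmul_eq_mul]
            have hc : ((Bs s).card : ℝ) = (N.choose s : ℝ) * (N.choose (lam * s)) := by
              simp [Bs]
            rw [hc]
            exact term_bound N lam s d hl hs.1.1 hs.2 hd
        _ ≤ ∑ s ∈ Finset.Icc 1 N, (1 / 4 : ℝ) ^ s :=
            Finset.sum_le_sum_of_subset_of_nonneg (Finset.filter_subset _ _)
              (fun _ _ _ => by positivity)
        _ < 1 := by
            have : ∀ M : ℕ, ∑ s ∈ Finset.Icc 1 M, (1 / 4 : ℝ) ^ s ≤ 1 / 3 - (1 / 4) ^ M / 3 := by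
              intro M
              induction M with
              | zero => simp
              | succ M ih =>
                rw [Finset.sum_Icc_succ_top (by omega), pow_succ]
                linarith
            have h := this N
            have : (0 : ℝ) < (1 / 4) ^ N := by positivity
            linarith)
    refine ⟨edgesOf N d g, ?_, edgesOf_lt _ _ _, ?_⟩
    · rw [edgesOf_length]; exact Nat.mul_le_mul_right _ (by omega)
    · intro S T hS hT h hc
      by_contra hlt
      push Not at hlt
      set s := T.card / lam + 1 with hs
      have hdiv : lam * (T.card / lam) ≤ T.card := Nat.mul_div_le _ _
      have hdiv2 : T.card < lam * s := by
        rw [hs]; exact Nat.lt_mul_div_succ _ (by omega)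
      have hlams : lam * s = lam * (T.card / lam) + lam := by rw [hs]; ring
      have hsS : s ≤ S.card := by
        by_contra hh
        push Not at hh
        have : S.card ≤ T.card / lam := by omega
        have := Nat.mul_le_mul_left lam this
        omega
      obtain ⟨S', hS', hS'c⟩ := Finset.exists_subset_card_eq
        (s := (Finset.univ : Finset (Fin N)).filter (fun v : Fin N => (v : ℕ) ∈ S)) (n := s)
        (by rw [preimage_card N S hS]; exact hsS)
      have hT2 := preimage_card N T hT
      obtain ⟨T', hT', hT'c⟩ := Finset.exists_superset_card_eq
        (s := (Finset.univ : Finset (Fin N)).filter (fun v : Fin N => (v : ℕ) ∈ T)) (n := lam * s)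
        (by rw [hT2]; omega) (by rw [Fintype.card_fin]; omega)
      have hsle : s ≤ lam * s := Nat.le_mul_of_pos_left _ (by omega)
      obtain ⟨v, hv, k, hk⟩ := hg (S', T') (by
        rw [Finset.mem_biUnion]
        refine ⟨s, ?_, ?_⟩
        · simp only [R, Finset.mem_filter, Finset.mem_Icc]
          refine ⟨⟨by rw [hs]; exact Nat.le_add_left _ _, by omega⟩, by omega⟩
        · simp only [Bs, Finset.mem_product, Finset.mem_powersetCard]
          exact ⟨⟨Finset.subset_univ _, hS'c⟩, Finset.subset_univ _, hT'c⟩)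
      apply hk
      apply hT'
      have hvS : (v : ℕ) ∈ S := by have := hS' hv; simpa using this
      simpa using h _ (mem_edgesOf N d g v k) hvS

theorem exists_halver (e : ℕ) (he : 2 ≤ e) : ∃ d : ℕ, ∀ N : ℕ,
    ∃ E : List (ℕ × ℕ), E.length ≤ d * N ∧ (∀ e ∈ E, e.1 < N ∧ e.2 < N) ∧
      ∀ S T : Finset ℕ, (∀ v ∈ S, v < N) → (∀ v ∈ T, v < N) →
        (∀ c ∈ E, c.1 ∈ S → c.2 ∈ T) → e * S.card ≤ N ∨ e * (N - T.card) ≤ N := by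
  classical
  have heR : (2 : ℝ) ≤ e := by exact_mod_cast he
  obtain ⟨D, hD⟩ := exists_pow_lt_of_lt_one (show (0 : ℝ) < 1 / 5 by norm_num)
    (show (1 - 1 / (e : ℝ)) < 1 by have : 0 < 1 / (e : ℝ) := by positivity
                                   linarith)
  have h0 : 0 ≤ 1 - 1 / (e : ℝ) := by
    rw [sub_nonneg, div_le_one (by linarith)]; linarith
  refine ⟨D * e, fun N => ?_⟩
  rcases Nat.eq_zero_or_pos N with rfl | hN
  · refine ⟨[], by simp, by simp, ?_⟩
    intro S T hS hT h
    right; simp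
  have hNR : (0 : ℝ) < N := by exact_mod_cast hN
  let B : Finset (Finset (Fin N) × Finset (Fin N)) :=
    Finset.univ.filter (fun p => N ≤ e * p.1.card ∧ N ≤ e * (N - p.2.card))
  obtain ⟨g, hg⟩ := exists_avoid N (D * e) hN B (by
    calc ∑ p ∈ B, ((p.2.card : ℝ) / N) ^ (D * e * p.1.card) ≤ ∑ p ∈ B, (1 / 5 : ℝ) ^ N := by
          apply Finset.sum_le_sum
          intro p hp
          simp only [B, Finset.mem_filter, Finset.mem_univ, true_and] at hp
          have hle : p.2.card ≤ N := by simpa using Finset.card_le_univ p.2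
          have h1 : (p.2.card : ℝ) / N ≤ 1 - 1 / e := by
            have : (N : ℝ) ≤ e * (N - p.2.card) := by
              have := hp.2
              rw [← Nat.cast_sub hle]; exact_mod_cast this
            rw [div_le_iff₀ hNR, sub_mul, one_mul]
            have h3 : (N : ℝ) / e ≤ N - p.2.card := by
              rw [div_le_iff₀ (by linarith)]; linarith
            have : 1 / (e : ℝ) * N = N / e := by ring
            linarith
          calc ((p.2.card : ℝ) / N) ^ (D * e * p.1.card) ≤ (1 - 1 / (e : ℝ)) ^ (D * e * p.1.card) := by
                gcongr
            _ = ((1 - 1 / (e : ℝ)) ^ D) ^ (e * p.1.card) := by rw [← pow_mul]; ring_nf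
            _ ≤ (1 / 5) ^ (e * p.1.card) := by gcongr
            _ ≤ (1 / 5) ^ N := pow_le_pow_of_le_one (by norm_num) (by norm_num) hp.1
      _ = B.card * (1 / 5 : ℝ) ^ N := by rw [Finset.sum_const, nsmul_eq_mul]
      _ ≤ 4 ^ N * (1 / 5 : ℝ) ^ N := by
          gcongr
          have : B.card ≤ 2 ^ N * 2 ^ N := by
            refine (Finset.card_filter_le _ _).trans ?_
            simp [Finset.card_univ]
          rw [← mul_pow] at this
          exact_mod_cast this
      _ = (4 / 5 : ℝ) ^ N := by rw [← mul_pow]; norm_num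
      _ < 1 := pow_lt_one₀ (by norm_num) (by norm_num) (by omega))
  refine ⟨edgesOf N _ g, ?_, edgesOf_lt _ _ _, ?_⟩
  · rw [edgesOf_length]
  · intro S T hS hT h
    by_contra hcon
    push Not at hcon
    have hS2 := preimage_card N S hS
    have hT2 := preimage_card N T hT
    obtain ⟨v, hv, k, hk⟩ := hg ((Finset.univ : Finset (Fin N)).filter (fun v : Fin N => (v : ℕ) ∈ S),
        (Finset.univ : Finset (Fin N)).filter (fun v : Fin N => (v : ℕ) ∈ T)) (by
      simp only [B, Finset.mem_filter, Finset.mem_univ, true_and]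
      rw [hS2, hT2]
      exact ⟨hcon.1.le, hcon.2.le⟩)
    apply hk
    have hvS : (v : ℕ) ∈ S := by simpa using hv
    simpa using h _ (mem_edgesOf N _ g v k) hvS
end SN

namespace SN

noncomputable def exE (lam N : ℕ) : List (ℕ × ℕ) :=
  (exists_expander (lam + 1) N (Nat.le_add_left _ _)).choose

noncomputable def haD : ℕ := (exists_halver 4000 (by norm_num)).choose
noncomputable def haE (N : ℕ) : List (ℕ × ℕ) :=
  ((exists_halver 4000 (by norm_num)).choose_spec N).choose

def place (E : List (ℕ × ℕ)) (p q : ℕ) : List (ℕ × ℕ) := E.map fun e => (p + e.1, q + e.2)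

theorem place_length (E : List (ℕ × ℕ)) (p q : ℕ) : (place E p q).length = E.length := by
  simp [place]

theorem exE_length (lam N : ℕ) : (exE lam N).length ≤ 9 * (lam + 1) * N :=
  (exists_expander (lam + 1) N (Nat.le_add_left _ _)).choose_spec.1
theorem haE_length (N : ℕ) : (haE N).length ≤ haD * N :=
  ((exists_halver 4000 (by norm_num)).choose_spec N).choose_spec.1
theorem exE_lt (lam N : ℕ) : ∀ e ∈ exE lam N, e.1 < N ∧ e.2 < N :=
  (exists_expander (lam + 1) N (Nat.le_add_left _ _)).choose_spec.2.1
theorem haE_lt (N : ℕ) : ∀ e ∈ haE N, e.1 < N ∧ e.2 < N :=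
  ((exists_halver 4000 (by norm_num)).choose_spec N).choose_spec.2.1

theorem cnt_shift (g : ℕ → Bool) (p N : ℕ) :
    ((Finset.range N).filter (fun v => g (p + v) = true)).card = cnt g p (p + N) := by
  unfold cnt on
  apply Finset.card_bij (fun v _ => p + v)
  · intro a ha; simp at ha ⊢; exact ha
  · intro a _ b _ h; omega
  · intro b hb
    simp only [Finset.mem_filter, Finset.mem_Ico] at hb
    refine ⟨b - p, ?_, by omega⟩
    have : p + (b - p) = b := by omega
    simp only [Finset.mem_filter, Finset.mem_range, this]
    exact ⟨by omega, hb.2⟩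

theorem place_exp (lam N p q : ℕ) (g : ℕ → Bool)
    (h : ∀ c ∈ place (exE lam N) p q, g c.1 ≤ g c.2) (hc : 4 * cnt g q (q + N) < N) :
    lam * cnt g p (p + N) ≤ cnt g q (q + N) := by
  have key := (exists_expander (lam + 1) N (Nat.le_add_left _ _)).choose_spec.2.2
    ((Finset.range N).filter (fun v => g (p + v) = true))
    ((Finset.range N).filter (fun v => g (q + v) = true))
    (by intro v hv; simp at hv; exact hv.1) (by intro v hv; simp at hv; exact hv.1)
    (by
      intro e he h1
      simp only [Finset.mem_filter, Finset.mem_range] at h1 ⊢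
      refine ⟨(exE_lt lam N e he).2, ?_⟩
      have := h (p + e.1, q + e.2) (List.mem_map_of_mem he)
      simp only [h1.2] at this
      revert this; cases g (q + e.2) <;> simp)
    (by rw [cnt_shift]; exact hc)
  rw [cnt_shift, cnt_shift] at key
  nlinarith

theorem place_hal (N p q : ℕ) (g : ℕ → Bool)
    (h : ∀ c ∈ place (haE N) p q, g c.1 ≤ g c.2) :
    4000 * cnt g p (p + N) ≤ N ∨ 4000 * cnz g q (q + N) ≤ N := by
  have key := ((exists_halver 4000 (by norm_num)).choose_spec N).choose_spec.2.2
    ((Finset.range N).filter (fun v => g (p + v) = true))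
    ((Finset.range N).filter (fun v => g (q + v) = true))
    (by intro v hv; simp at hv; exact hv.1) (by intro v hv; simp at hv; exact hv.1)
    (by
      intro e he h1
      simp only [Finset.mem_filter, Finset.mem_range] at h1 ⊢
      refine ⟨(haE_lt N e he).2, ?_⟩
      have := h (p + e.1, q + e.2) (List.mem_map_of_mem he)
      simp only [h1.2] at this
      revert this; cases g (q + e.2) <;> simp)
  rw [cnt_shift, cnt_shift] at key
  have := cnt_add_cnz g q (q + N)
  rcases key with key | key
  · left; exact key
  · right
    have e : N - cnt g q (q + N) = cnz g q (q + N) := by omega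
    rwa [e] at key

theorem mem_place {E : List (ℕ × ℕ)} {N p q : ℕ} (hE : ∀ e ∈ E, e.1 < N ∧ e.2 < N)
    {c : ℕ × ℕ} (hc : c ∈ place E p q) : ∃ u < N, ∃ v < N, c = (p + u, q + v) := by
  obtain ⟨e, he, rfl⟩ := List.mem_map.1 hc
  exact ⟨e.1, (hE e he).1, e.2, (hE e he).2, rfl⟩

/-- compress layer -/
noncomputable def Cl (b r m lam : ℕ) : List (ℕ × ℕ) :=
  (List.range m).flatMap fun i =>
    place (exE lam (2 ^ r)) (i * b + (b - 2 ^ (r + 1))) (i * b + (b - 2 ^ r))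

/-- move layer over a list of block indices -/
noncomputable def Mo (b r h lam : ℕ) (l : List ℕ) : List (ℕ × ℕ) :=
  l.flatMap fun i =>
    place (exE lam (2 ^ r)) (i * b + (b - 2 ^ r)) ((i + h) * b + (b - 2 ^ r))

noncomputable def Ml (b r h m lam : ℕ) : List (ℕ × ℕ) := Mo b r h lam (List.range (m - h))

theorem mem_Cl {b r m lam : ℕ} (hb : 2 ^ (r + 1) ≤ b) {c : ℕ × ℕ} (hc : c ∈ Cl b r m lam) :
    ∃ i < m, ∃ u v, b - 2 ^ (r + 1) ≤ u ∧ u < b - 2 ^ r ∧ b - 2 ^ r ≤ v ∧ v < b ∧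
      c = (i * b + u, i * b + v) := by
  obtain ⟨i, hi, hc⟩ := List.mem_flatMap.1 hc
  obtain ⟨u, hu, v, hv, rfl⟩ := mem_place (exE_lt _ _) hc
  have : 2 ^ (r + 1) = 2 * 2 ^ r := by ring
  refine ⟨i, List.mem_range.1 hi, b - 2 ^ (r + 1) + u, b - 2 ^ r + v, ?_, ?_, ?_, ?_, ?_⟩
  any_goals omega
  simp only [Prod.mk.injEq]; omega

theorem mem_Mo {b r h lam : ℕ} {l : List ℕ} (hb : 2 ^ r ≤ b) {c : ℕ × ℕ} (hc : c ∈ Mo b r h lam l) :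
    ∃ i ∈ l, ∃ u v, b - 2 ^ r ≤ u ∧ u < b ∧ b - 2 ^ r ≤ v ∧ v < b ∧
      c = (i * b + u, (i + h) * b + v) := by
  obtain ⟨i, hi, hc⟩ := List.mem_flatMap.1 hc
  obtain ⟨u, hu, v, hv, rfl⟩ := mem_place (exE_lt _ _) hc
  refine ⟨i, hi, b - 2 ^ r + u, b - 2 ^ r + v, ?_, ?_, ?_, ?_, ?_⟩
  any_goals omega
  simp only [Prod.mk.injEq]; omega

theorem blk_lt {i m b u : ℕ} (hi : i < m) (hu : u < b) : i * b + u < m * b := by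
  have : (i + 1) * b ≤ m * b := Nat.mul_le_mul_right _ hi
  have : (i + 1) * b = i * b + b := by ring
  omega

theorem mul_add_mod_lt {i b u : ℕ} (hu : u < b) : (i * b + u) % b = u := by
  rw [Nat.mul_comm, Nat.mul_add_mod, Nat.mod_eq_of_lt hu]

theorem Std_Cl {b r m lam : ℕ} (hb : 2 ^ (r + 1) ≤ b) : Std (m * b) (Cl b r m lam) := by
  intro c hc
  obtain ⟨i, hi, u, v, h1, h2, h3, h4, rfl⟩ := mem_Cl hb hc
  exact ⟨by dsimp; omega, blk_lt hi h4⟩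

theorem Std_Ml {b r h m lam : ℕ} (hb : 2 ^ r ≤ b) (hh : 1 ≤ h) : Std (m * b) (Ml b r h m lam) := by
  intro c hc
  obtain ⟨i, hi, u, v, h1, h2, h3, h4, rfl⟩ := mem_Mo hb hc
  rw [List.mem_range] at hi
  have : (i + 1) * b ≤ (i + h) * b := Nat.mul_le_mul_right _ (by omega)
  have : (i + 1) * b = i * b + b := by ring
  exact ⟨by dsimp; omega, blk_lt (by omega) h4⟩

/-- only touches tails of size `2^r` -/
def Tch (b r : ℕ) (L : List (ℕ × ℕ)) : Prop :=
  ∀ c ∈ L, b ≤ c.1 % b + 2 ^ r ∧ b ≤ c.2 % b + 2 ^ r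

theorem Tch.append {b r} {L M : List (ℕ × ℕ)} (h : Tch b r L) (h' : Tch b r M) :
    Tch b r (L ++ M) := by
  intro c hc
  rcases List.mem_append.1 hc with hc | hc
  · exact h c hc
  · exact h' c hc

theorem Tch.mono {b r r'} {L : List (ℕ × ℕ)} (h : Tch b r L) (hr : r ≤ r') : Tch b r' L := by
  intro c hc
  have := h c hc
  have : 2 ^ r ≤ 2 ^ r' := Nat.pow_le_pow_right (by norm_num) hr
  omega

theorem Tch_Cl {b r m lam : ℕ} (hb : 2 ^ (r + 1) ≤ b) : Tch b (r + 1) (Cl b r m lam) := by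
  intro c hc
  obtain ⟨i, hi, u, v, h1, h2, h3, h4, rfl⟩ := mem_Cl hb hc
  have : 2 ^ (r + 1) = 2 * 2 ^ r := by ring
  rw [mul_add_mod_lt (by omega), mul_add_mod_lt h4]
  omega

theorem Tch_Mo {b r h lam : ℕ} {l : List ℕ} (hb : 2 ^ r ≤ b) : Tch b r (Mo b r h lam l) := by
  intro c hc
  obtain ⟨i, hi, u, v, h1, h2, h3, h4, rfl⟩ := mem_Mo hb hc
  rw [mul_add_mod_lt h2, mul_add_mod_lt h4]
  omega

/-- ones in the first `X` blocks outside the tails -/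
def Out (b : ℕ) (f : ℕ → Bool) (X r : ℕ) : ℕ :=
  ∑ i ∈ Finset.range X, cnt f (i * b) (i * b + (b - 2 ^ r))

theorem Out_run {b r : ℕ} {L : List (ℕ × ℕ)} (h : Tch b r L) (f : ℕ → Bool) (X : ℕ) :
    Out b (run L f) X r = Out b f X r := by
  unfold Out
  apply Finset.sum_congr rfl
  intro i _
  apply cnt_congr
  intro v h1 h2
  apply run_untouched
  intro c hc
  have hv : v % b + 2 ^ r < b := by
    obtain ⟨w, rfl⟩ := Nat.exists_eq_add_of_le h1
    have : 0 < 2 ^ r := by positivity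
    rw [mul_add_mod_lt (by omega)]; omega
  have := h c hc
  constructor
  · rintro rfl; omega
  · rintro rfl; omega

theorem Out_mono (b : ℕ) (f : ℕ → Bool) {X Y : ℕ} (r : ℕ) (h : X ≤ Y) : Out b f X r ≤ Out b f Y r :=
  Finset.sum_le_sum_of_subset (Finset.range_mono h)

theorem cnt_blocks0 (f : ℕ → Bool) (b X : ℕ) :
    cnt f 0 (X * b) = ∑ i ∈ Finset.range X, cnt f (i * b) ((i + 1) * b) := by
  rw [cnt_blocks f b 0 X (Nat.zero_le _)]; simp

theorem Cstep {b r m lam : ℕ} (hb : 2 ^ (r + 1) ≤ b) (f : ℕ → Bool) (X : ℕ) (hX : X ≤ m)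
    (hc : 4 * cnt f 0 (X * b) < 2 ^ r) :
    lam * ∑ i ∈ Finset.range X, cnt (run (Cl b r m lam) f) (i * b + (b - 2 ^ (r + 1)))
      (i * b + (b - 2 ^ r)) ≤ cnt f 0 (X * b) := by
  set g := run (Cl b r m lam) f with hg
  have hle : cnt g 0 (X * b) ≤ cnt f 0 (X * b) :=
    cnt_run_front _ _ _ (fun c hc => (Std_Cl hb c hc).1)
  have hlay : ∀ c ∈ Cl b r m lam, g c.1 ≤ g c.2 := by
    apply run_layer (fun v => v % b + 2 ^ r < b)
    intro c hc
    obtain ⟨i, hi, u, v, h1, h2, h3, h4, rfl⟩ := mem_Cl hb hc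
    dsimp only
    rw [mul_add_mod_lt (by omega), mul_add_mod_lt h4]
    omega
  have hp : 2 ^ (r + 1) = 2 * 2 ^ r := by ring
  refine le_trans ?_ hle
  rw [Finset.mul_sum, cnt_blocks0]
  apply Finset.sum_le_sum
  intro i hi
  rw [Finset.mem_range] at hi
  have e1 : i * b + (b - 2 ^ (r + 1)) + 2 ^ r = i * b + (b - 2 ^ r) := by omega
  have e2 : i * b + (b - 2 ^ r) + 2 ^ r = (i + 1) * b := by
    have : (i + 1) * b = i * b + b := by ring
    omega
  have h3 : (i + 1) * b ≤ X * b := Nat.mul_le_mul_right _ hi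
  have := place_exp lam (2 ^ r) (i * b + (b - 2 ^ (r + 1))) (i * b + (b - 2 ^ r)) g
    (fun c hc => hlay c (List.mem_flatMap.2 ⟨i, List.mem_range.2 (by omega), hc⟩))
    (by
      rw [e2]
      have := cnt_mono g (Nat.zero_le (i * b + (b - 2 ^ r))) h3
      omega)
  rw [e1, e2] at this
  refine this.trans (cnt_mono _ (by omega) le_rfl)

/-- compression network -/
noncomputable def Cn (k m Lam : ℕ) : ℕ → List (ℕ × ℕ)
  | 0 => []
  | j + 1 => Cn k m Lam j ++ Cl (2 ^ k) (k - 1 - j) m (Lam * ((j + 1) * (j + 2)))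

theorem Std_Cn (k m Lam j : ℕ) (hj : j ≤ k) : Std (m * 2 ^ k) (Cn k m Lam j) := by
  induction j with
  | zero => intro c hc; simp [Cn] at hc
  | succ j ih =>
    exact (ih (by omega)).append (Std_Cl (Nat.pow_le_pow_right (by norm_num) (by omega)))

theorem Cn_split (k m Lam j j' : ℕ) (h : j ≤ j') (h' : j' ≤ k) :
    ∃ R, Cn k m Lam j' = Cn k m Lam j ++ R ∧ Tch (2 ^ k) (k - j) R := by
  induction j', h using Nat.le_induction with
  | base => exact ⟨[], by simp, by intro c hc; simp at hc⟩
  | succ j' h ih =>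
    obtain ⟨R, hR, hT⟩ := ih (by omega)
    refine ⟨R ++ Cl (2 ^ k) (k - 1 - j') m (Lam * ((j' + 1) * (j' + 2))), ?_, ?_⟩
    · rw [Cn, hR, List.append_assoc]
    · exact hT.append ((Tch_Cl (Nat.pow_le_pow_right (by norm_num) (by omega))).mono (by omega))

theorem Cn_out (k m Lam j : ℕ) (hj : j ≤ k) (f : ℕ → Bool) (X : ℕ) (hX : X ≤ m)
    (hc : 4 * cnt f 0 (X * 2 ^ k) < 2 ^ (k - j)) :
    Lam * (j + 1) * Out (2 ^ k) (run (Cn k m Lam j) f) X (k - j) ≤ j * cnt f 0 (X * 2 ^ k) := by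
  induction j with
  | zero => simp [Out]
  | succ j ih =>
    obtain ⟨r, hr⟩ : ∃ r, k - j = r + 1 := ⟨k - j - 1, by omega⟩
    have hr2 : k - (j + 1) = r := by omega
    have hr3 : k - 1 - j = r := by omega
    have hb : 2 ^ (r + 1) ≤ 2 ^ k := Nat.pow_le_pow_right (by norm_num) (by omega)
    have hp : 2 ^ (r + 1) = 2 * 2 ^ r := by ring
    rw [hr2] at hc ⊢
    have ih := ih (by omega) (by rw [hr]; omega)
    rw [hr] at ih
    simp only [Cn, hr3, run_append]
    set f1 := run (Cn k m Lam j) f with hf1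
    have hle : cnt f1 0 (X * 2 ^ k) ≤ cnt f 0 (X * 2 ^ k) :=
      cnt_run_front _ _ _ (fun c hc => (Std_Cn k m Lam j (by omega) c hc).1)
    have hs := Cstep (b := 2 ^ k) (r := r) (m := m) (lam := Lam * ((j + 1) * (j + 2))) hb f1 X hX
      (by omega)
    set g := run (Cl (2 ^ k) r m (Lam * ((j + 1) * (j + 2)))) f1 with hg
    have hO : Out (2 ^ k) g X (r + 1) = Out (2 ^ k) f1 X (r + 1) := Out_run (Tch_Cl hb) f1 X
    have hsum : Out (2 ^ k) g X r = Out (2 ^ k) g X (r + 1) +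
        ∑ i ∈ Finset.range X, cnt g (i * 2 ^ k + (2 ^ k - 2 ^ (r + 1)))
      (i * 2 ^ k + (2 ^ k - 2 ^ r)) := by
      unfold Out
      rw [← Finset.sum_add_distrib]
      apply Finset.sum_congr rfl
      intro i _
      rw [cnt_add] <;> omega
    rw [hsum, hO]
    set A := Out (2 ^ k) f1 X (r + 1)
    set B := ∑ i ∈ Finset.range X, cnt g (i * 2 ^ k + (2 ^ k - 2 ^ (r + 1)))
      (i * 2 ^ k + (2 ^ k - 2 ^ r))
    set P := cnt f 0 (X * 2 ^ k)
    have hs' := hs.trans hle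
    have : (j + 1) * (Lam * (j + 1 + 1) * (A + B)) ≤ (j + 1) * ((j + 1) * P) := by
      calc (j + 1) * (Lam * (j + 1 + 1) * (A + B))
          = (j + 2) * (Lam * (j + 1) * A) + Lam * ((j + 1) * (j + 2)) * B := by ring
        _ ≤ (j + 2) * (j * P) + P := by gcongr
        _ = (j + 1) * ((j + 1) * P) := by ring
    exact Nat.le_of_mul_le_mul_left this (by omega)

theorem C_out (k m Lam r : ℕ) (hr : r ≤ k) (f : ℕ → Bool) (X : ℕ) (hX : X ≤ m)
    (hc : 4 * cnt f 0 (X * 2 ^ k) < 2 ^ r) :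
    Lam * Out (2 ^ k) (run (Cn k m Lam k) f) X r ≤ cnt f 0 (X * 2 ^ k) := by
  obtain ⟨R, hR, hT⟩ := Cn_split k m Lam (k - r) k (by omega) le_rfl
  have e : k - (k - r) = r := by omega
  rw [hR, run_append]
  rw [e] at hT
  rw [Out_run hT]
  have := Cn_out k m Lam (k - r) (by omega) f X hX (by rw [e]; exact hc)
  rw [e] at this
  set A := Out (2 ^ k) (run (Cn k m Lam (k - r)) f) X r
  have h2 : (k - r + 1) * (Lam * A) ≤ (k - r + 1) * cnt f 0 (X * 2 ^ k) := by
    calc _ = Lam * (k - r + 1) * A := by ring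
      _ ≤ _ := this
      _ ≤ _ := by gcongr; omega
  exact Nat.le_of_mul_le_mul_left h2 (by omega)

theorem Mstep {b r h m lam : ℕ} (hb : 2 ^ r ≤ b) (hh : 1 ≤ h) (f : ℕ → Bool) (X : ℕ)
    (hX : X + h ≤ m) (hc : 4 * cnt f 0 ((X + h) * b) < 2 ^ r) :
    lam * cnt (run (Ml b r h m lam) f) 0 (X * b) ≤
      lam * cnt f 0 ((X - h) * b) + (lam * Out b f X r + cnt f 0 ((X + h) * b)) := by
  set a := X - h with ha
  have hsplit : List.range (m - h) = List.range' 0 a ++ (List.range' a (X - a) ++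
      List.range' X (m - h - X)) := by
    rw [List.range_eq_range']
    have h1 : List.range' a (X - a) ++ List.range' X (m - h - X) = List.range' a (m - h - a) := by
      have := List.range'_append (s := a) (m := X - a) (n := m - h - X) (step := 1)
      have e1 : a + 1 * (X - a) = X := by omega
      have e2 : X - a + (m - h - X) = m - h - a := by omega
      rw [e1, e2] at this
      exact this
    rw [h1]
    have := List.range'_append (s := 0) (m := a) (n := m - h - a) (step := 1)
    have e1 : 0 + 1 * a = a := by omega
    have e2 : a + (m - h - a) = m - h := by omega
    rw [e1, e2] at this
    exact this.symm
  have hstd : Std (m * b) (Ml b r h m lam) := Std_Ml hb hh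
  have hML : Ml b r h m lam = Mo b r h lam (List.range' 0 a) ++ (Mo b r h lam (List.range' a (X - a)) ++
      Mo b r h lam (List.range' X (m - h - X))) := by
    unfold Ml; rw [hsplit]; simp [Mo]
  have hstd1 : ∀ c ∈ Mo b r h lam (List.range' 0 a), c.1 < c.2 := fun c hc =>
    (hstd c (by rw [hML]; simp [hc])).1
  have hstd2 : ∀ c ∈ Mo b r h lam (List.range' a (X - a)), c.1 < c.2 := fun c hc =>
    (hstd c (by rw [hML]; simp [hc])).1
  have hstd3 : ∀ c ∈ Mo b r h lam (List.range' X (m - h - X)), c.1 < c.2 := fun c hc =>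
    (hstd c (by rw [hML]; simp [hc])).1
  rw [hML, run_append, run_append]
  set f1 := run (Mo b r h lam (List.range' 0 a)) f with hf1
  set g := run (Mo b r h lam (List.range' a (X - a))) f1 with hg
  refine (Nat.mul_le_mul_left lam (cnt_run_front _ g _ hstd3)).trans ?_
  have hP : ∀ x, cnt g 0 x ≤ cnt f 0 x := fun x =>
    (cnt_run_front _ f1 _ hstd2).trans (cnt_run_front _ f _ hstd1)
  have hO : Out b g X r = Out b f X r := by
    rw [hg, Out_run (Tch_Mo hb), hf1, Out_run (Tch_Mo hb)]
  have hlay : ∀ c ∈ Mo b r h lam (List.range' a (X - a)), g c.1 ≤ g c.2 := by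
    apply run_layer (fun v => v < X * b)
    intro c hc
    obtain ⟨i, hi, u, v, h1, h2, h3, h4, rfl⟩ := mem_Mo hb hc
    rw [List.mem_range'_1] at hi
    dsimp only
    constructor
    · exact blk_lt (by omega) h2
    · have : X * b ≤ (i + h) * b := Nat.mul_le_mul_right _ (by omega)
      omega
  have haX : a ≤ X := by omega
  rw [cnt_blocks g b a X haX]
  have hblk : ∀ i, cnt g (i * b) ((i + 1) * b) = cnt g (i * b) (i * b + (b - 2 ^ r)) +
      cnt g (i * b + (b - 2 ^ r)) ((i + 1) * b) := by
    intro i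
    have : (i + 1) * b = i * b + b := by ring
    rw [cnt_add] <;> omega
  rw [Finset.sum_congr rfl (fun i _ => hblk i), Finset.sum_add_distrib]
  have hout : ∑ i ∈ Finset.Ico a X, cnt g (i * b) (i * b + (b - 2 ^ r)) ≤ Out b f X r := by
    rw [← hO]; unfold Out
    apply Finset.sum_le_sum_of_subset
    intro i hi; simp at hi ⊢; omega
  have htail : lam * ∑ i ∈ Finset.Ico a X, cnt g (i * b + (b - 2 ^ r)) ((i + 1) * b) ≤
      cnt f 0 ((X + h) * b) := by
    refine le_trans ?_ (hP _)
    rw [cnt_blocks0 g b (X + h), Finset.mul_sum]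
    calc ∑ i ∈ Finset.Ico a X, lam * cnt g (i * b + (b - 2 ^ r)) ((i + 1) * b)
        ≤ ∑ i ∈ Finset.Ico a X, cnt g ((i + h) * b) ((i + h + 1) * b) := by
          apply Finset.sum_le_sum
          intro i hi
          rw [Finset.mem_Ico] at hi
          have e1 : i * b + (b - 2 ^ r) + 2 ^ r = (i + 1) * b := by
            have : (i + 1) * b = i * b + b := by ring
            omega
          have e2 : (i + h) * b + (b - 2 ^ r) + 2 ^ r = (i + h + 1) * b := by
            have : (i + h + 1) * b = (i + h) * b + b := by ring
            omega
          have h3 : (i + h + 1) * b ≤ (X + h) * b := Nat.mul_le_mul_right _ (by omega)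
          have := place_exp lam (2 ^ r) (i * b + (b - 2 ^ r)) ((i + h) * b + (b - 2 ^ r)) g
            (fun c hc => hlay c (List.mem_flatMap.2 ⟨i, List.mem_range'_1.2 (by omega), hc⟩))
            (by
              rw [e2]
              have h5 := cnt_mono g (Nat.zero_le ((i + h) * b + (b - 2 ^ r))) h3
              have h6 := hP ((X + h) * b)
              omega)
          rw [e1, e2] at this
          exact this.trans (cnt_mono _ (by omega) le_rfl)
      _ = ∑ i ∈ Finset.Ico (a + h) (X + h), cnt g (i * b) ((i + 1) * b) := by
          rw [← Finset.sum_Ico_add' (fun i => cnt g (i * b) ((i + 1) * b)) a X h]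
      _ ≤ _ := by
          apply Finset.sum_le_sum_of_subset
          intro i hi; simp at hi ⊢; omega
  have h7 := hP (a * b)
  calc _ = lam * cnt g 0 (a * b) + (lam * ∑ i ∈ Finset.Ico a X, cnt g (i * b) (i * b + (b - 2 ^ r)) +
        lam * ∑ i ∈ Finset.Ico a X, cnt g (i * b + (b - 2 ^ r)) ((i + 1) * b)) := by ring
    _ ≤ _ := by gcongr

/-- iterate a network -/
def pw : ℕ → List (ℕ × ℕ) → List (ℕ × ℕ)
  | 0, _ => []
  | q + 1, L => pw q L ++ L

theorem mem_pw {q : ℕ} {L : List (ℕ × ℕ)} {c : ℕ × ℕ} (h : c ∈ pw q L) : c ∈ L := by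
  induction q with
  | zero => simp [pw] at h
  | succ q ih =>
    rcases List.mem_append.1 h with h | h
    · exact ih h
    · exact h

theorem pw_length (q : ℕ) (L : List (ℕ × ℕ)) : (pw q L).length = q * L.length := by
  induction q with
  | zero => simp [pw]
  | succ q ih => simp [pw, ih]; ring

theorem Mq {b r h m lam : ℕ} (hb : 2 ^ r ≤ b) (hh : 1 ≤ h) (f : ℕ → Bool) (X : ℕ)
    (hX : X + h ≤ m) (hc : 4 * cnt f 0 ((X + h) * b) < 2 ^ r) (q : ℕ) (X' : ℕ) (hX' : X' ≤ X) :
    lam * cnt (run (pw q (Ml b r h m lam)) f) 0 (X' * b) ≤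
      lam * cnt f 0 ((X' - q * h) * b) + q * (lam * Out b f X r + cnt f 0 ((X + h) * b)) := by
  induction q generalizing X' with
  | zero => simp [pw]
  | succ q ih =>
    rw [pw, run_append]
    set g := run (pw q (Ml b r h m lam)) f with hg
    have hP : ∀ x, cnt g 0 x ≤ cnt f 0 x := fun x =>
      cnt_run_front _ _ _ (fun c hc => (Std_Ml hb hh c (mem_pw hc)).1)
    have hle : (X' + h) * b ≤ (X + h) * b := Nat.mul_le_mul_right _ (by omega)
    have h1 : cnt g 0 ((X' + h) * b) ≤ cnt f 0 ((X + h) * b) :=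
      (hP _).trans (cnt_mono _ le_rfl hle)
    have hO : Out b g X' r ≤ Out b f X r := by
      have hT : Tch b r (pw q (Ml b r h m lam)) := fun c hc => Tch_Mo hb c (mem_pw hc)
      rw [hg, Out_run hT]
      exact Out_mono _ _ _ hX'
    have h2 := Mstep (lam := lam) hb hh g X' (m := m) (by omega) (by omega)
    have h3 := ih (X' - h) (by omega)
    have e : X' - h - q * h = X' - (q + 1) * h := by
      rw [Nat.sub_sub]; congr 1; ring
    rw [e] at h3
    calc _ ≤ _ := h2
      _ ≤ lam * cnt f 0 ((X' - (q + 1) * h) * b) + q * (lam * Out b f X r + cnt f 0 ((X + h) * b))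
          + (lam * Out b f X r + cnt f 0 ((X + h) * b)) := by gcongr
      _ = _ := by ring

noncomputable def Ma (k m lam : ℕ) : ℕ → List (ℕ × ℕ)
  | 0 => []
  | r + 1 => Ma k m lam r ++ pw 60 (Ml (2 ^ k) r (2 ^ (k - r)) m lam)

theorem Std_Ma (k m lam r : ℕ) (hr : r ≤ k + 1) : Std (m * 2 ^ k) (Ma k m lam r) := by
  induction r with
  | zero => intro c hc; simp [Ma] at hc
  | succ r ih =>
    refine (ih (by omega)).append (fun c hc => ?_)
    exact Std_Ml (Nat.pow_le_pow_right (by norm_num) (by omega)) Nat.one_le_two_pow c (mem_pw hc)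

theorem Tch_Ma (k m lam r : ℕ) (hr : r ≤ k + 1) : Tch (2 ^ k) r (Ma k m lam r) := by
  induction r with
  | zero => intro c hc; simp [Ma] at hc
  | succ r ih =>
    refine ((ih (by omega)).mono (by omega)).append (fun c hc => ?_)
    exact ((Tch_Mo (Nat.pow_le_pow_right (by norm_num) (by omega))).mono (Nat.le_succ r)) c (mem_pw hc)

theorem Ma_mono (k m lam r r' : ℕ) (h : r ≤ r') (h' : r' ≤ k + 1) (f : ℕ → Bool) (x : ℕ) :
    cnt (run (Ma k m lam r') f) 0 x ≤ cnt (run (Ma k m lam r) f) 0 x := by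
  induction r', h using Nat.le_induction with
  | base => exact le_rfl
  | succ r' h ih =>
    refine le_trans ?_ (ih (by omega))
    rw [Ma, run_append]
    refine cnt_run_front _ _ _ (fun c hc => ?_)
    exact (Std_Ml (m := m) (Nat.pow_le_pow_right (by norm_num) (by omega)) Nat.one_le_two_pow c (mem_pw hc)).1

noncomputable def CM (k m : ℕ) : List (ℕ × ℕ) := Cn k m 3840 k ++ Ma k m 3840 (k + 1)

theorem Std_CM (k m : ℕ) : Std (m * 2 ^ k) (CM k m) :=
  (Std_Cn _ _ _ _ le_rfl).append (Std_Ma _ _ _ _ le_rfl)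

set_option maxHeartbeats 1000000 in
theorem CM_improve (k m Z : ℕ) (f : ℕ → Bool) (hZ : Z ≤ m * 2 ^ k)
    (hpre : ∀ X, X * 2 ^ k ≤ Z → 8 * (cnt f 0 (X * 2 ^ k) * (Z - X * 2 ^ k)) ≤ 2 ^ k * 2 ^ k)
    (X : ℕ) (hX : X * 2 ^ k + 4 * 2 ^ k ≤ Z) :
    64 * (cnt (run (CM k m) f) 0 (X * 2 ^ k) * (Z - X * 2 ^ k)) ≤ 2 ^ k * 2 ^ k := by
  have hb0 : 0 < 2 ^ k := by positivity
  set b := 2 ^ k with hb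
  set y := Z - X * b with hy
  have hmono : cnt (run (CM k m) f) 0 (X * b) ≤ cnt f 0 (X * b) :=
    cnt_run_front _ _ _ (fun c hc => (Std_CM k m c hc).1)
  -- choose the scale
  obtain ⟨t, ht1, ht2⟩ : ∃ t, 2 ^ (t + 1) * b ≤ y ∧ y < 2 ^ (t + 2) * b := by
    have hq : 4 ≤ y / b := by rw [Nat.le_div_iff_mul_le hb0]; omega
    refine ⟨Nat.log 2 (y / b) - 1, ?_, ?_⟩
    · have hl : 1 ≤ Nat.log 2 (y / b) := by
        apply Nat.log_pos (by norm_num); omega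
      have := Nat.pow_log_le_self 2 (x := y / b) (by omega)
      rw [Nat.sub_add_cancel hl, ← Nat.le_div_iff_mul_le hb0]; exact this
    · have hl : 1 ≤ Nat.log 2 (y / b) := by
        apply Nat.log_pos (by norm_num); omega
      have := Nat.lt_pow_succ_log_self (b := 2) (by norm_num) (y / b)
      rw [show Nat.log 2 (y / b) - 1 + 2 = (Nat.log 2 (y / b)).succ by omega]
      exact (Nat.div_lt_iff_lt_mul hb0).1 this
  rcases lt_or_ge k t with hkt | hkt
  · have h1 := hpre X (by omega)
    have h2 : 2 ^ (k + 1) ≤ 2 ^ (t + 1) := Nat.pow_le_pow_right (by norm_num) (by omega)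
    have h3 : 2 ^ (k + 1) = 2 * b := by rw [hb]; ring
    have h4 : 2 * b * b ≤ y := (Nat.mul_le_mul_right b (by omega)).trans ht1
    have h5 : cnt f 0 (X * b) = 0 := by
      by_contra hne
      have h6 : 1 ≤ cnt f 0 (X * b) := Nat.pos_of_ne_zero hne
      have h7 : 1 * y ≤ cnt f 0 (X * b) * y := Nat.mul_le_mul_right _ h6
      nlinarith
    have h6 : cnt (run (CM k m) f) 0 (X * b) = 0 := by omega
    rw [h6]; simp
  · set h := 2 ^ t with hh
    have hh1 : 1 ≤ h := Nat.one_le_two_pow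
    obtain ⟨r, hr⟩ : ∃ r, k = t + r := ⟨k - t, by omega⟩
    have hbr : b = h * 2 ^ r := by rw [hb, hh, hr, pow_add]
    have hkr : k - r = t := by omega
    have ht1' : 2 * h * b ≤ y := by
      have : 2 ^ (t + 1) * b = 2 * h * b := by rw [hh]; ring
      omega
    have ht2' : y < 4 * h * b := by
      have : 2 ^ (t + 2) * b = 4 * h * b := by rw [hh]; ring
      omega
    have l2 : 2 * h * b = 2 * (h * b) := by ring
    have l4 : 4 * h * b = 4 * (h * b) := by ring
    have l60 : 60 * h * b = 60 * (h * b) := by ring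
    have hXh : (X + h) * b = X * b + h * b := by ring
    have hXm : X + h ≤ m := by
      have : (X + h) * b ≤ m * b := by omega
      exact Nat.le_of_mul_le_mul_right this hb0
    have hp1 := hpre (X + h) (by rw [hXh]; omega)
    have e1 : Z - (X + h) * b = y - h * b := by rw [hXh]; omega
    rw [e1] at hp1
    set P1 := cnt f 0 ((X + h) * b) with hP1
    have hyh : h * b ≤ y - h * b := by
      have : 2 * h * b = h * b + h * b := by ring
      omega
    have hyh2 : y ≤ 2 * (y - h * b) := by omega
    have hcap : 4 * P1 < 2 ^ r := by
      have h1 : 8 * (P1 * (h * b)) ≤ b * b :=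
        (Nat.mul_le_mul_left 8 (Nat.mul_le_mul_left P1 hyh)).trans hp1
      have h2 : 8 * (P1 * h) ≤ b := by
        apply Nat.le_of_mul_le_mul_right _ hb0
        calc 8 * (P1 * h) * b = 8 * (P1 * (h * b)) := by ring
          _ ≤ b * b := h1
      have h3 : 8 * P1 ≤ 2 ^ r := by
        apply Nat.le_of_mul_le_mul_left _ (show 0 < h by omega)
        calc h * (8 * P1) = 8 * (P1 * h) := by ring
          _ ≤ b := h2
          _ = h * 2 ^ r := hbr
      have : 0 < 2 ^ r := by positivity
      omega
    have hPX : cnt f 0 (X * b) ≤ P1 := cnt_mono _ le_rfl (by omega)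
    have hO := C_out k m 3840 r (by omega) f X (by omega) (by rw [← hb]; omega)
    rw [← hb] at hO
    set f1 := run (Cn k m 3840 k) f with hf1
    set f2 := run (Ma k m 3840 r) f1 with hf2
    have hO2 : Out b f2 X r = Out b f1 X r := Out_run (Tch_Ma k m 3840 r (by omega)) f1 X
    have hP2 : ∀ x, cnt f2 0 x ≤ cnt f 0 x := fun x =>
      (cnt_run_front _ _ _ (fun c hc => (Std_Ma k m 3840 r (by omega) c hc).1)).trans
        (cnt_run_front _ _ _ (fun c hc => (Std_Cn k m 3840 k le_rfl c hc).1))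
    have hM := Mq (b := b) (r := r) (h := h) (m := m) (lam := 3840) (by rw [hbr]; exact Nat.le_mul_of_pos_left _ (by omega)) hh1 f2 X hXm
      (by have := hP2 ((X + h) * b); omega) 60 X le_rfl
    have hfin : cnt (run (CM k m) f) 0 (X * b) ≤
        cnt (run (pw 60 (Ml b r h m 3840)) f2) 0 (X * b) := by
      rw [CM, run_append, ← hf1]
      refine (Ma_mono k m 3840 (r + 1) (k + 1) (by omega) le_rfl f1 (X * b)).trans ?_
      rw [Ma, run_append, hkr]
    set F := cnt (run (CM k m) f) 0 (X * b) with hF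
    set P0 := cnt f 0 ((X - 60 * h) * b) with hP0
    have hA : 3840 * F ≤ 3840 * P0 + 60 * (P1 + P1) := by
      refine (Nat.mul_le_mul_left 3840 hfin).trans (hM.trans ?_)
      rw [hO2]
      have h1 := hP2 ((X - 60 * h) * b)
      have h2 := hP2 ((X + h) * b)
      omega
    have hB : 128 * (P0 * y) ≤ b * b := by
      rcases Nat.lt_or_ge X (60 * h) with hlt | hge
      · have : X - 60 * h = 0 := by omega
        rw [hP0, this]; simp
      · have h1 := hpre (X - 60 * h) (by
          have : (X - 60 * h) * b ≤ X * b := Nat.mul_le_mul_right _ (by omega)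
          omega)
        have e2 : (X - 60 * h) * b + 60 * h * b = X * b := by
          rw [← Nat.add_mul]; congr 1; omega
        have e3 : Z - (X - 60 * h) * b = y + 60 * h * b := by omega
        rw [e3] at h1
        have h4 : 16 * y ≤ y + 60 * h * b := by omega
        calc 128 * (P0 * y) = 8 * (P0 * (16 * y)) := by ring
          _ ≤ 8 * (P0 * (y + 60 * h * b)) := by gcongr
          _ ≤ b * b := h1
    have hC : 4 * (P1 * y) ≤ b * b := by
      calc 4 * (P1 * y) ≤ 4 * (P1 * (2 * (y - h * b))) := by gcongr
        _ = 8 * (P1 * (y - h * b)) := by ring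
        _ ≤ b * b := hp1
    have hD : 3840 * F * y ≤ (3840 * P0 + 60 * (P1 + P1)) * y := Nat.mul_le_mul_right y hA
    have d1 : 3840 * F * y = 3840 * (F * y) := by ring
    have d2 : (3840 * P0 + 60 * (P1 + P1)) * y = 3840 * (P0 * y) + 120 * (P1 * y) := by ring
    omega

end SN

namespace SN

noncomputable def Inn (b j w : ℕ) : List (ℕ × ℕ) :=
  (List.range' (j + 1) w).flatMap fun j' => place (haE b) (j * b) (j' * b)

noncomputable def Sel (b : ℕ) : ℕ → ℕ → List (ℕ × ℕ)
  | 0, _ => []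
  | w + 1, j => Inn b j w ++ Sel b w (j + 1)

theorem mem_Inn {b j w : ℕ} {c : ℕ × ℕ} (hc : c ∈ Inn b j w) :
    ∃ j', j < j' ∧ j' < j + 1 + w ∧ j * b ≤ c.1 ∧ c.1 < (j + 1) * b ∧ j' * b ≤ c.2 ∧
      c.2 < (j' + 1) * b := by
  obtain ⟨j', hj', hc⟩ := List.mem_flatMap.1 hc
  rw [List.mem_range'_1] at hj'
  obtain ⟨u, hu, v, hv, rfl⟩ := mem_place (haE_lt _) hc
  have e1 : (j + 1) * b = j * b + b := by ring
  have e2 : (j' + 1) * b = j' * b + b := by ring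
  refine ⟨j', by omega, by omega, ?_, ?_, ?_, ?_⟩ <;> dsimp only <;> omega

theorem Inn_range {b j w : ℕ} {c : ℕ × ℕ} (hc : c ∈ Inn b j w) :
    j * b ≤ c.1 ∧ c.1 < (j + 1) * b ∧ (j + 1) * b ≤ c.2 ∧ c.2 < (j + 1 + w) * b := by
  obtain ⟨j', h1, h2, h3, h4, h5, h6⟩ := mem_Inn hc
  have e1 : (j + 1) * b ≤ j' * b := Nat.mul_le_mul_right _ h1
  have e2 : (j' + 1) * b ≤ (j + 1 + w) * b := Nat.mul_le_mul_right _ (by omega)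
  omega

theorem Sel_range {b w j : ℕ} {c : ℕ × ℕ} (hc : c ∈ Sel b w j) :
    c.1 < c.2 ∧ j * b ≤ c.1 ∧ c.2 < (j + w) * b := by
  induction w generalizing j with
  | zero => simp [Sel] at hc
  | succ w ih =>
    rcases List.mem_append.1 hc with hc | hc
    · have := Inn_range hc
      have e : (j + (w + 1)) * b = (j + 1 + w) * b := by ring
      omega
    · have := ih hc
      have e : (j + (w + 1)) * b = (j + 1 + w) * b := by ring
      have e1 : (j + 1) * b = j * b + b := by ring
      omega

theorem Inn_good (b j w : ℕ) (f : ℕ → Bool) :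
    4000 * cnt (run (Inn b j w) f) (j * b) ((j + 1) * b) ≤ b ∨
    ∀ j', j < j' → j' < j + 1 + w →
      4000 * cnz (run (Inn b j w) f) (j' * b) ((j' + 1) * b) ≤ b := by
  set g := run (Inn b j w) f with hg
  have hlay : ∀ c ∈ Inn b j w, g c.1 ≤ g c.2 := by
    apply run_layer (fun v => v < (j + 1) * b)
    intro c hc
    have := Inn_range hc
    omega
  by_contra hcon
  push Not at hcon
  obtain ⟨h1, j', h2, h3, h4⟩ := hcon
  have := place_hal b (j * b) (j' * b) g
    (fun c hc => hlay c (List.mem_flatMap.2 ⟨j', List.mem_range'_1.2 (by omega), hc⟩))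
  have e1 : (j + 1) * b = j * b + b := by ring
  have e2 : (j' + 1) * b = j' * b + b := by ring
  rw [e1] at h1
  rw [e2] at h4
  omega

theorem cnz_blocks_le (f : ℕ → Bool) (b a w D : ℕ)
    (h : ∀ j', a ≤ j' → j' < a + w → D * cnz f (j' * b) ((j' + 1) * b) ≤ b) :
    D * cnz f (a * b) ((a + w) * b) ≤ w * b := by
  induction w with
  | zero => simp
  | succ w ih =>
    have h1 := ih (fun j' h1 h2 => h j' h1 (by omega))
    have h2 := h (a + w) (by omega) (by omega)
    have h3 := cnz_add f (a := a * b) (b := (a + w) * b) (c := (a + (w + 1)) * b)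
      (Nat.mul_le_mul_right _ (by omega)) (Nat.mul_le_mul_right _ (by omega))
    rw [← h3, Nat.mul_add]
    have e : (w + 1) * b = w * b + b := by ring
    rw [show a + (w + 1) = a + w + 1 by ring]
    omega

theorem Sel_good (b w j : ℕ) (f : ℕ → Bool) (i : ℕ) (hi : i ≤ w) :
    4000 * cnt (run (Sel b w j) f) (j * b) ((j + i) * b) ≤ i * b ∨
    4000 * cnz (run (Sel b w j) f) ((j + i) * b) ((j + w) * b) ≤ w * b := by
  induction w generalizing j f i with
  | zero =>
    left
    obtain rfl : i = 0 := by omega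
    simp
  | succ w ih =>
    rcases i with _ | i
    · left; simp
    · rw [Sel, run_append]
      set g1 := run (Inn b j w) f with hg1
      set g := run (Sel b w (j + 1)) g1 with hg
      have e1 : (j + 1) * b = j * b + b := by ring
      have e2 : j + (i + 1) = j + 1 + i := by ring
      have e3 : j + (w + 1) = j + 1 + w := by ring
      have e4 : (w + 1) * b = w * b + b := by ring
      have e5 : (i + 1) * b = i * b + b := by ring
      rw [e2, e3]
      have hle : (j + 1) * b ≤ (j + 1 + i) * b := Nat.mul_le_mul_right _ (by omega)
      rcases ih (j + 1) g1 i (by omega) with h | h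
      · rcases Inn_good b j w f with h' | h'
        · left
          rw [← cnt_add g (b := (j + 1) * b) (by omega) hle]
          have : cnt g (j * b) ((j + 1) * b) = cnt g1 (j * b) ((j + 1) * b) := by
            apply cnt_congr
            intro v hv1 hv2
            apply run_untouched
            intro c hc
            have := Sel_range hc
            omega
          rw [← hg1, ← this] at h'
          rw [← hg] at h
          omega
        · right
          have h2 := cnz_blocks_le g1 b (j + 1) w 4000 (fun j' h1 h2 => h' j' (by omega) (by omega))
          have h3 : cnz g ((j + 1) * b) ((j + 1 + w) * b) = cnz g1 ((j + 1) * b) ((j + 1 + w) * b) := by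
            apply cnz_run_eq
            · exact fun c hc => (Sel_range hc).1
            · intro c hc
              have := Sel_range hc
              omega
          have h4 := cnz_mono g hle (le_refl ((j + 1 + w) * b))
          omega
      · right
        rw [← hg] at h
        omega

noncomputable def Win (b m : ℕ) : List (ℕ × ℕ) :=
  (List.range m).flatMap fun j => Sel b (min 20 (m - j)) j

theorem Std_Sel (b m j w : ℕ) (h : j + w ≤ m) : Std (m * b) (Sel b w j) := by
  intro c hc
  have := Sel_range hc
  have : (j + w) * b ≤ m * b := Nat.mul_le_mul_right _ h
  omega

theorem Std_Win (b m : ℕ) : Std (m * b) (Win b m) :=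
  Std.flatMap (fun j hj => Std_Sel _ _ _ _ (by rw [List.mem_range] at hj; omega))

theorem Win_good (b m j : ℕ) (hj : j < m) (f : ℕ → Bool) (i : ℕ) (hi : i ≤ min 20 (m - j)) :
    4000 * cnt (run (Win b m) f) 0 ((j + i) * b) ≤ 4000 * cnt f 0 (j * b) + 20 * b ∨
    4000 * cnz (run (Win b m) f) ((j + i) * b) (m * b) ≤
      4000 * cnz f ((j + min 20 (m - j)) * b) (m * b) + 20 * b := by
  have hmem : j ∈ List.range m := List.mem_range.2 hj
  obtain ⟨l1, l2, hl⟩ := List.append_of_mem hmem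
  set w := min 20 (m - j) with hw
  have hWin : Win b m = l1.flatMap (fun j => Sel b (min 20 (m - j)) j) ++ (Sel b w j ++
      l2.flatMap (fun j => Sel b (min 20 (m - j)) j)) := by
    unfold Win; rw [hl]; simp [hw]
  have hstd := Std_Win b m
  set A := l1.flatMap (fun j => Sel b (min 20 (m - j)) j)
  set B := l2.flatMap (fun j => Sel b (min 20 (m - j)) j)
  have hA : Std (m * b) A := fun c hc => hstd c (by rw [hWin]; simp [hc])
  have hB : Std (m * b) B := fun c hc => hstd c (by rw [hWin]; simp [hc])
  have hS : Std (m * b) (Sel b w j) := fun c hc => hstd c (by rw [hWin]; simp [hc])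
  rw [hWin, run_append, run_append]
  set f1 := run A f
  set g := run (Sel b w j) f1 with hg
  have hwb : w * b ≤ 20 * b := Nat.mul_le_mul_right _ (by omega)
  have hib : i * b ≤ 20 * b := Nat.mul_le_mul_right _ (by omega)
  have m1 : j * b ≤ (j + i) * b := Nat.mul_le_mul_right _ (by omega)
  have m2 : (j + i) * b ≤ (j + w) * b := Nat.mul_le_mul_right _ (by omega)
  have m3 : (j + w) * b ≤ m * b := Nat.mul_le_mul_right _ (by omega)
  rcases Sel_good b w j f1 i hi with h | h
  · left
    have h1 := cnt_run_front B g ((j + i) * b) (fun c hc => (hB c hc).1)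
    have h2 := cnt_run_front (Sel b w j) f1 (j * b) (fun c hc => (hS c hc).1)
    have h3 := cnt_run_front A f (j * b) (fun c hc => (hA c hc).1)
    have h4 := cnt_add g (Nat.zero_le (j * b)) m1
    rw [← hg] at h h2
    change cnt f1 0 (j * b) ≤ _ at h3
    omega
  · right
    have h1 := cnz_run_suffix B g ((j + i) * b) hB
    have h2 := cnz_run_suffix (Sel b w j) f1 ((j + w) * b) hS
    have h3 := cnz_run_suffix A f ((j + w) * b) hA
    have h4 := cnz_add g m2 m3
    rw [← hg] at h h2
    change cnz f1 ((j + w) * b) (m * b) ≤ _ at h3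
    omega

/-- progress invariant at scale `B` -/
def Inv (B n : ℕ) (f : ℕ → Bool) : Prop :=
  (∀ X, X * B + 4 * B ≤ cnz f 0 n → 64 * (cnt f 0 (X * B) * (cnz f 0 n - X * B)) ≤ B * B) ∧
  (∀ X, X * B ≤ n → cnz f 0 n + 4 * B ≤ X * B →
    64 * (cnz f (X * B) n * (X * B - cnz f 0 n)) ≤ B * B)

def Pre (b n : ℕ) (f : ℕ → Bool) : Prop :=
  (∀ X, X * b ≤ cnz f 0 n → 8 * (cnt f 0 (X * b) * (cnz f 0 n - X * b)) ≤ b * b) ∧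
  (∀ X, X * b ≤ n → cnz f 0 n ≤ X * b →
    8 * (cnz f (X * b) n * (X * b - cnz f 0 n)) ≤ b * b) ∧
  (∀ X, X * b ≤ cnz f 0 n → cnz f 0 n < X * b + 9 * b → 78 * cnt f 0 (X * b) ≤ b)

theorem Inv_farP {b n : ℕ} (hb : 0 < b) {f : ℕ → Bool} (h : Inv (2 * b) n f) (X : ℕ)
    (hX : X * b + 9 * b ≤ cnz f 0 n) :
    8 * (cnt f 0 (X * b) * (cnz f 0 n - X * b)) ≤ b * b ∧ 128 * cnt f 0 (X * b) ≤ b := by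
  set Z := cnz f 0 n
  have e : (X + 1) / 2 * (2 * b) ≤ X * b + b := by
    calc (X + 1) / 2 * (2 * b) = (X + 1) / 2 * 2 * b := by ring
      _ ≤ (X + 1) * b := Nat.mul_le_mul_right _ (Nat.div_mul_le_self _ _)
      _ = _ := by ring
  have e' : X * b ≤ (X + 1) / 2 * (2 * b) := by
    calc X * b ≤ (X + 1) / 2 * 2 * b := Nat.mul_le_mul_right _ (by omega)
      _ = _ := by ring
  have h1 := h.1 ((X + 1) / 2) (by change _ ≤ Z; omega)
  change 64 * (_ * (Z - _)) ≤ _ at h1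
  set x' := (X + 1) / 2 * (2 * b)
  have hP : cnt f 0 (X * b) ≤ cnt f 0 x' := cnt_mono _ le_rfl e'
  have h2 : 64 * (cnt f 0 (X * b) * (Z - X * b - b)) ≤ 4 * (b * b) := by
    calc _ ≤ 64 * (cnt f 0 x' * (Z - x')) :=
          Nat.mul_le_mul_left 64 (Nat.mul_le_mul hP (by omega))
      _ ≤ 2 * b * (2 * b) := h1
      _ = _ := by ring
  set P := cnt f 0 (X * b)
  set y := Z - X * b with hy
  have h3 : P * y ≤ P * (2 * (y - b)) := Nat.mul_le_mul_left _ (by omega)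
  have h4 : P * (2 * (y - b)) = 2 * (P * (y - b)) := by ring
  have h5 : P * (8 * b) ≤ P * (y - b) := Nat.mul_le_mul_left _ (by omega)
  constructor
  · omega
  · apply Nat.le_of_mul_le_mul_right _ hb
    calc 128 * P * b = 16 * (P * (8 * b)) := by ring
      _ ≤ b * b := by omega

theorem Inv_farQ {b n : ℕ} (hb : 0 < b) {f : ℕ → Bool} (h : Inv (2 * b) n f) (X : ℕ)
    (hXn : X * b ≤ n) (hX : cnz f 0 n + 9 * b ≤ X * b) :
    8 * (cnz f (X * b) n * (X * b - cnz f 0 n)) ≤ b * b ∧ 128 * cnz f (X * b) n ≤ b := by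
  set Z := cnz f 0 n
  have e : X / 2 * (2 * b) ≤ X * b := by
    calc X / 2 * (2 * b) = X / 2 * 2 * b := by ring
      _ ≤ X * b := Nat.mul_le_mul_right _ (Nat.div_mul_le_self _ _)
  have e' : X * b ≤ X / 2 * (2 * b) + b := by
    calc X * b ≤ (X / 2 * 2 + 1) * b := Nat.mul_le_mul_right _ (by omega)
      _ = _ := by ring
  have h1 := h.2 (X / 2) (by omega) (by change Z + _ ≤ _; omega)
  change 64 * (_ * (_ - Z)) ≤ _ at h1
  set x' := X / 2 * (2 * b)
  have hP : cnz f (X * b) n ≤ cnz f x' n := cnz_mono _ e le_rfl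
  have h2 : 64 * (cnz f (X * b) n * (X * b - Z - b)) ≤ 4 * (b * b) := by
    calc _ ≤ 64 * (cnz f x' n * (x' - Z)) :=
          Nat.mul_le_mul_left 64 (Nat.mul_le_mul hP (by omega))
      _ ≤ 2 * b * (2 * b) := h1
      _ = _ := by ring
  set P := cnz f (X * b) n
  set y := X * b - Z with hy
  have h3 : P * y ≤ P * (2 * (y - b)) := Nat.mul_le_mul_left _ (by omega)
  have h4 : P * (2 * (y - b)) = 2 * (P * (y - b)) := by ring
  have h5 : P * (8 * b) ≤ P * (y - b) := Nat.mul_le_mul_left _ (by omega)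
  constructor
  · omega
  · apply Nat.le_of_mul_le_mul_right _ hb
    calc 128 * P * b = 16 * (P * (8 * b)) := by ring
      _ ≤ b * b := by omega

theorem Win_pre (b m : ℕ) (hb : 0 < b) (hm : 0 < m) (f : ℕ → Bool) (h : Inv (2 * b) (m * b) f) :
    Pre b (m * b) (run (Win b m) f) := by
  have hZ := cnz_run_total (Win b m) f (Std_Win b m)
  have hPm := fun x => cnt_run_front (Win b m) f x (fun c hc => (Std_Win b m c hc).1)
  have hQm := fun x => cnz_run_suffix (Win b m) f x (Std_Win b m)
  have hbal := fun x (hx : x ≤ m * b) => balance (run (Win b m) f) hx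
  have hgood := fun j hj i hi => Win_good b m j hj f i hi
  have farP := fun X hX => Inv_farP hb h X hX
  have farQ := fun X h1 hX => Inv_farQ hb h X h1 hX
  have hZn : cnz f 0 (m * b) ≤ m * b := by
    have := cnt_add_cnz f 0 (m * b); omega
  unfold Pre
  rw [hZ] at hbal ⊢
  set g := run (Win b m) f
  set Z := cnz f 0 (m * b)
  obtain ⟨z, hz1, hz2⟩ : ∃ z, z * b ≤ Z ∧ Z < z * b + b :=
    ⟨Z / b, Nat.div_mul_le_self _ _, by have := Nat.lt_div_mul_add hb (a := Z); omega⟩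
  have hzm : z ≤ m := Nat.le_of_mul_le_mul_right (hz1.trans hZn) hb
  -- near estimate
  have near : ∀ X, X ≤ m → z ≤ X + 9 → X ≤ z + 10 →
      78 * cnt g 0 (X * b) ≤ b ∨ 78 * cnz g (X * b) (m * b) ≤ b := by
    intro X hXm h1 h2
    obtain ⟨i, rfl⟩ : ∃ i, X = (z - 9) + i := ⟨X - (z - 9), by omega⟩
    have := hgood (z - 9) (by omega) i (by omega)
    have hP0 : 128 * cnt f 0 ((z - 9) * b) ≤ b := by
      rcases Nat.lt_or_ge z 9 with h9 | h9
      · have : z - 9 = 0 := by omega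
        rw [this]; simp
      · refine (farP (z - 9) ?_).2
        have : (z - 9) * b + 9 * b = z * b := by rw [← Nat.add_mul]; congr 1; omega
        omega
    have hQ0 : 128 * cnz f ((z - 9 + min 20 (m - (z - 9))) * b) (m * b) ≤ b := by
      rcases Nat.lt_or_ge (m - (z - 9)) 20 with h9 | h9
      · have : z - 9 + min 20 (m - (z - 9)) = m := by omega
        rw [this]; simp
      · refine (farQ _ (Nat.mul_le_mul_right _ (by omega)) ?_).2
        have : (z + 10) * b ≤ (z - 9 + min 20 (m - (z - 9))) * b :=
          Nat.mul_le_mul_right _ (by omega)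
        have e : (z + 10) * b = z * b + 10 * b := by ring
        omega
    omega
  have nearP : ∀ X, X * b ≤ Z → Z < X * b + 9 * b → 78 * cnt g 0 (X * b) ≤ b := by
    intro X hX hf
    have hXz : X ≤ z := by
      have : X * b < (z + 1) * b := by rw [Nat.add_mul]; omega
      have := Nat.lt_of_mul_lt_mul_right this
      omega
    have hXz2 : z < X + 9 := by
      have : z * b < (X + 9) * b := by rw [Nat.add_mul]; omega
      exact Nat.lt_of_mul_lt_mul_right this
    have h1 := near X (by omega) (by omega) (by omega)
    have h2 := hbal (X * b) (by omega)
    omega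
  refine ⟨?_, ?_, nearP⟩
  · intro X hX
    rcases le_or_gt (X * b + 9 * b) Z with hf | hf
    · refine le_trans ?_ (farP X hf).1
      have := hPm (X * b)
      gcongr
    · have h3 := nearP X hX hf
      calc 8 * (cnt g 0 (X * b) * (Z - X * b)) ≤ 8 * (cnt g 0 (X * b) * (9 * b)) := by
            gcongr; omega
        _ = (72 * cnt g 0 (X * b)) * b := by ring
        _ ≤ b * b := Nat.mul_le_mul_right _ (by omega)
  · intro X hXn hX
    rcases le_or_gt (Z + 9 * b) (X * b) with hf | hf
    · refine le_trans ?_ (farQ X hXn hf).1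
      have := hQm (X * b)
      gcongr
    · have hXz : z ≤ X := Nat.le_of_mul_le_mul_right (hz1.trans hX) hb
      have hXz2 : X < z + 10 := by
        have : X * b < (z + 10) * b := by rw [Nat.add_mul]; omega
        exact Nat.lt_of_mul_lt_mul_right this
      have h1 := near X (Nat.le_of_mul_le_mul_right hXn hb) (by omega) (by omega)
      have h2 := hbal (X * b) hXn
      have h3 : 78 * cnz g (X * b) (m * b) ≤ b := by omega
      calc 8 * (cnz g (X * b) (m * b) * (X * b - Z)) ≤ 8 * (cnz g (X * b) (m * b) * (9 * b)) := by
            gcongr; omega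
        _ = (72 * cnz g (X * b) (m * b)) * b := by ring
        _ ≤ b * b := Nat.mul_le_mul_right _ (by omega)

end SN

namespace SN

def mirL (n : ℕ) (L : List (ℕ × ℕ)) : List (ℕ × ℕ) := L.map fun c => (n - 1 - c.2, n - 1 - c.1)

theorem Std_mirL {n : ℕ} {L : List (ℕ × ℕ)} (h : Std n L) : Std n (mirL n L) := by
  intro c hc
  obtain ⟨e, he, rfl⟩ := List.mem_map.1 hc
  have := h e he
  dsimp only
  omega

theorem run_mir {n : ℕ} (L : List (ℕ × ℕ)) (hL : Std n L) (f f' : ℕ → Bool)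
    (h : ∀ v < n, f' v = !f (n - 1 - v)) : ∀ v < n, run (mirL n L) f' v = !run L f (n - 1 - v) := by
  induction L generalizing f f' with
  | nil => exact h
  | cons c L ih =>
    have hc := hL c (by simp)
    have : mirL n (c :: L) = (n - 1 - c.2, n - 1 - c.1) :: mirL n L := rfl
    rw [this, run_cons, run_cons]
    apply ih (fun d hd => hL d (by simp [hd]))
    intro v hv
    have e1 := h (n - 1 - c.2) (by omega)
    have e2 := h (n - 1 - c.1) (by omega)
    rw [show n - 1 - (n - 1 - c.2) = c.2 by omega] at e1
    rw [show n - 1 - (n - 1 - c.1) = c.1 by omega] at e2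
    have e3 := h v hv
    unfold cx
    dsimp only
    rw [e1, e2, e3]
    by_cases a : v = n - 1 - c.2
    · rw [if_pos a, if_neg (by omega), if_pos (by omega)]
      cases f c.1 <;> cases f c.2 <;> rfl
    · rw [if_neg a]
      by_cases a' : v = n - 1 - c.1
      · rw [if_pos a', if_pos (by omega)]
        cases f c.1 <;> cases f c.2 <;> rfl
      · rw [if_neg a', if_neg (by omega), if_neg (by omega)]

theorem cnt_mir {n : ℕ} {g h : ℕ → Bool} (H : ∀ v < n, g v = !h (n - 1 - v)) {x : ℕ} (hx : x ≤ n) :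
    cnt h 0 x = cnz g (n - x) n := by
  unfold cnz cnt on
  apply Finset.card_bij (fun v _ => n - 1 - v)
  · intro a ha
    simp only [Finset.mem_filter, Finset.mem_Ico] at ha ⊢
    refine ⟨by omega, ?_⟩
    rw [H _ (by omega), show n - 1 - (n - 1 - a) = a by omega, ha.2]; rfl
  · intro a ha c hc hh
    simp only [Finset.mem_filter, Finset.mem_Ico] at ha hc
    omega
  · intro c hc
    simp only [Finset.mem_filter, Finset.mem_Ico] at hc
    refine ⟨n - 1 - c, ?_, by omega⟩
    simp only [Finset.mem_filter, Finset.mem_Ico]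
    refine ⟨by omega, ?_⟩
    have := hc.2
    rw [H _ (by omega)] at this
    simpa using this

noncomputable def Level (k m : ℕ) : List (ℕ × ℕ) :=
  Win (2 ^ k) m ++ (CM k m ++ mirL (m * 2 ^ k) (CM k m))

theorem Std_Level (k m : ℕ) : Std (m * 2 ^ k) (Level k m) :=
  (Std_Win _ _).append ((Std_CM _ _).append (Std_mirL (Std_CM _ _)))

theorem Pre_run {k m : ℕ} {f : ℕ → Bool} (L : List (ℕ × ℕ)) (hL : Std (m * 2 ^ k) L)
    (h : Pre (2 ^ k) (m * 2 ^ k) f) : Pre (2 ^ k) (m * 2 ^ k) (run L f) := by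
  unfold Pre at h ⊢
  rw [cnz_run_total L f hL]
  have h1 := fun x => cnt_run_front L f x (fun c hc => (hL c hc).1)
  have h2 := fun x => cnz_run_suffix L f x hL
  refine ⟨fun X hX => ?_, fun X hX hX' => ?_, fun X hX hX' => ?_⟩
  · exact (Nat.mul_le_mul_left 8 (Nat.mul_le_mul_right _ (h1 _))).trans (h.1 X hX)
  · exact (Nat.mul_le_mul_left 8 (Nat.mul_le_mul_right _ (h2 _))).trans (h.2.1 X hX hX')
  · exact (Nat.mul_le_mul_left 78 (h1 _)).trans (h.2.2 X hX hX')

theorem mir_improve (k m : ℕ) (f : ℕ → Bool) (h : Pre (2 ^ k) (m * 2 ^ k) f) (X : ℕ)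
    (hXn : X * 2 ^ k ≤ m * 2 ^ k) (hX : cnz f 0 (m * 2 ^ k) + 4 * 2 ^ k ≤ X * 2 ^ k) :
    64 * (cnz (run (mirL (m * 2 ^ k) (CM k m)) f) (X * 2 ^ k) (m * 2 ^ k) *
      (X * 2 ^ k - cnz f 0 (m * 2 ^ k))) ≤ 2 ^ k * 2 ^ k := by
  have hS := Std_CM k m
  have hci := CM_improve k m
  generalize CM k m = C at *
  have hb0 : 0 < 2 ^ k := by positivity
  unfold Pre at h
  generalize 2 ^ k = b at *
  set n := m * b with hn
  set fs : ℕ → Bool := fun v => !f (n - 1 - v) with hfs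
  have H : ∀ v < n, f v = !fs (n - 1 - v) := by
    intro v hv
    simp only [hfs, Bool.not_not]
    congr 1; omega
  have H2 := run_mir C hS fs f H
  set Z := cnz f 0 n with hZ
  have hZn : Z ≤ n := by have := cnt_add_cnz f 0 n; omega
  have hXm : X ≤ m := Nat.le_of_mul_le_mul_right hXn hb0
  have hsub : ∀ Y, Y ≤ m → n - Y * b = (m - Y) * b := by
    intro Y hY; rw [hn, Nat.sub_mul]
  have := hci (n - Z) fs (by omega) (by
    intro Y hY
    have hYm : Y ≤ m := Nat.le_of_mul_le_mul_right (show Y * b ≤ m * b by omega) hb0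
    rw [cnt_mir H (by omega), hsub Y hYm]
    have e := hsub Y hYm
    have := h.2.1 (m - Y) (by omega) (by omega)
    rw [show n - Z - Y * b = (m - Y) * b - Z by omega]
    exact this) (m - X) (by rw [← hsub X hXm]; omega)
  rw [cnt_mir H2 (by rw [← hsub X hXm]; omega), ← hsub X hXm] at this
  rw [show n - (n - X * b) = X * b by omega, show n - Z - (n - X * b) = X * b - Z by omega] at this
  exact this

theorem Level_good (k m : ℕ) (hm : 0 < m) (f : ℕ → Bool)
    (h : Inv (2 * 2 ^ k) (m * 2 ^ k) f) : Inv (2 ^ k) (m * 2 ^ k) (run (Level k m) f) := by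
  have hb0 : 0 < 2 ^ k := by positivity
  have h1 := Win_pre (2 ^ k) m hb0 hm f h
  have h2 := Pre_run (CM k m) (Std_CM k m) h1
  unfold Level
  rw [run_append, run_append]
  set f1 := run (Win (2 ^ k) m) f
  set f2 := run (CM k m) f1 with hf2
  have e2 : cnz f2 0 (m * 2 ^ k) = cnz f1 0 (m * 2 ^ k) := cnz_run_total _ _ (Std_CM k m)
  have e3 := cnz_run_total _ f2 (Std_mirL (Std_CM k m))
  have hZn : cnz f1 0 (m * 2 ^ k) ≤ m * 2 ^ k := by
    have := cnt_add_cnz f1 0 (m * 2 ^ k); omega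
  unfold Inv
  rw [e3]
  constructor
  · intro X hX
    rw [e2] at hX ⊢
    refine le_trans ?_ (CM_improve k m _ f1 hZn h1.1 X hX)
    rw [← hf2]
    exact Nat.mul_le_mul_left 64 (Nat.mul_le_mul_right _
      (cnt_run_front _ _ _ (fun c hc => (Std_mirL (Std_CM k m) c hc).1)))
  · intro X hXn hX
    exact mir_improve k m f2 h2 X hXn hX

noncomputable def Net (K : ℕ) : ℕ → List (ℕ × ℕ)
  | 0 => []
  | i + 1 => Net K i ++ Level (K - i) (2 ^ i)

theorem two_split (K i : ℕ) (h : i ≤ K) : 2 ^ i * 2 ^ (K - i) = 2 ^ K := by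
  rw [← pow_add]; congr 1; omega

theorem Std_Net (K i : ℕ) (h : i ≤ K + 1) : Std (2 ^ K) (Net K i) := by
  induction i with
  | zero => intro c hc; simp [Net] at hc
  | succ i ih =>
    refine (ih (by omega)).append ?_
    have := Std_Level (K - i) (2 ^ i)
    rwa [two_split K i (by omega)] at this

theorem Net_inv (K i : ℕ) (h : i ≤ K) (f : ℕ → Bool) :
    Inv (2 * 2 ^ (K - i)) (2 ^ K) (run (Net K i) f) := by
  induction i with
  | zero =>
    have h0 : 0 < 2 ^ K := by positivity
    have hZ : cnz f 0 (2 ^ K) ≤ 2 ^ K := by have := cnt_add_cnz f 0 (2 ^ K); omega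
    constructor
    · intro X hX
      simp only [Net, run_nil, Nat.sub_zero] at hX
      omega
    · intro X hXn hX
      simp only [Net, run_nil, Nat.sub_zero] at hX hXn
      omega
  | succ i ih =>
    have h1 := ih (by omega)
    rw [← two_split K i (by omega)] at h1
    have h2 := Level_good (K - i) (2 ^ i) (by positivity) _ h1
    rw [two_split K i (by omega)] at h2
    rw [Net, run_append]
    have e : 2 * 2 ^ (K - (i + 1)) = 2 ^ (K - i) := by
      rw [← pow_succ']; congr 1; omega
    rw [e]; exact h2

theorem Net_P (K : ℕ) (f : ℕ → Bool) :
    cnt (run (Net K (K + 1)) f) 0 (cnz (run (Net K (K + 1)) f) 0 (2 ^ K)) = 0 := by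
  have h1 := Net_inv K K le_rfl f
  rw [Net, run_append]
  set f1 := run (Net K K) f
  have hS := Std_Level (K - K) (2 ^ K)
  simp only [Nat.sub_self, pow_zero, mul_one] at h1 hS ⊢
  rw [cnz_run_total _ _ hS]
  have h2 := Win_pre 1 (2 ^ K) one_pos (by positivity) f1 (by simpa using h1)
  have hW := Std_Win 1 (2 ^ K)
  simp only [mul_one] at h2 hW
  have h3 := h2.2.2 (cnz f1 0 (2 ^ K))
  rw [cnz_run_total _ _ hW] at h3
  have h4 := h3 (by omega) (by omega)
  unfold Level
  rw [run_append]
  simp only [pow_zero, mul_one] at *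
  have h5 : Std (2 ^ K) (CM 0 (2 ^ K) ++ mirL (2 ^ K) (CM 0 (2 ^ K))) := by
    have := (Std_CM 0 (2 ^ K)).append (Std_mirL (Std_CM 0 (2 ^ K)))
    simpa using this
  have h6 := cnt_run_front _ (run (Win 1 (2 ^ K)) f1) (cnz f1 0 (2 ^ K)) (fun c hc => (h5 c hc).1)
  omega

theorem Net_sorted_bool (K : ℕ) (f : ℕ → Bool) (u w : ℕ) (huw : u < w) (hw : w < 2 ^ K)
    (hu : run (Net K (K + 1)) f u = true) : run (Net K (K + 1)) f w = true := by
  have h := Net_P K f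
  set g := run (Net K (K + 1)) f
  set Z := cnz g 0 (2 ^ K) with hZ
  have hZn : Z ≤ 2 ^ K := by have := cnt_add_cnz g 0 (2 ^ K); omega
  have hb := balance g hZn
  have hQ : cnz g Z (2 ^ K) = 0 := by omega
  have huZ : Z ≤ u := by
    by_contra hlt
    unfold cnt on at h
    rw [Finset.card_eq_zero] at h
    have : u ∈ (Finset.Ico 0 Z).filter (fun v => g v = true) := by
      simp only [Finset.mem_filter, Finset.mem_Ico]; exact ⟨by omega, hu⟩
    rw [h] at this
    simp at this
  by_contra hne
  unfold cnz cnt on at hQ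
  rw [Finset.card_eq_zero] at hQ
  have : w ∈ (Finset.Ico Z (2 ^ K)).filter (fun v => (!g v) = true) := by
    simp only [Finset.mem_filter, Finset.mem_Ico]; exact ⟨by omega, by simpa using hne⟩
  rw [hQ] at this
  simp at this

theorem run_thr (L : List (ℕ × ℕ)) (f : ℕ → ℕ) (T : ℕ) :
    (fun v => decide (T ≤ run L f v)) = run L (fun v => decide (T ≤ f v)) := by
  induction L generalizing f with
  | nil => rfl
  | cons c L ih =>
    rw [run_cons, run_cons, ih]
    congr 1
    funext v
    unfold cx
    split_ifs
    · by_cases a : T ≤ f c.1 <;> by_cases b : T ≤ f c.2 <;> simp [a, b]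
    · by_cases a : T ≤ f c.1 <;> by_cases b : T ≤ f c.2 <;> simp [a, b]
    · rfl

theorem Net_sorted (K : ℕ) (f : ℕ → ℕ) (u w : ℕ) (huw : u < w) (hw : w < 2 ^ K) :
    run (Net K (K + 1)) f u ≤ run (Net K (K + 1)) f w := by
  have h := run_thr (Net K (K + 1)) f (run (Net K (K + 1)) f u)
  have h1 := Net_sorted_bool K (fun v => decide (run (Net K (K + 1)) f u ≤ f v)) u w huw hw
  rw [← h] at h1
  simpa using h1

theorem run_pad (n M : ℕ) (L : List (ℕ × ℕ)) (hL : ∀ c ∈ L, c.1 < c.2) (f fh : ℕ → ℕ)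
    (h1 : ∀ v < n, fh v = f v) (h2 : ∀ v, n ≤ v → fh v = M) (h3 : ∀ v < n, f v ≤ M) :
    ∀ v < n, run (L.filter (fun c => c.2 < n)) f v = run L fh v := by
  induction L generalizing f fh with
  | nil => intro v hv; simp [h1 v hv]
  | cons c L ih =>
    have hc := hL c (by simp)
    have hL' : ∀ c ∈ L, c.1 < c.2 := fun d hd => hL d (by simp [hd])
    by_cases hn : c.2 < n
    · rw [List.filter_cons_of_pos (by simpa using hn), run_cons, run_cons]
      have e1 := h1 c.1 (by omega)
      have e2 := h1 c.2 (by omega)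
      have l1 := h3 c.1 (by omega)
      have l2 := h3 c.2 (by omega)
      apply ih hL'
      · intro v hv; unfold cx; rw [e1, e2, h1 v hv]
      · intro v hv; unfold cx
        rw [if_neg (by omega), if_neg (by omega)]; exact h2 v hv
      · intro v hv; unfold cx
        split_ifs
        · exact (min_le_left _ _).trans l1
        · exact max_le l1 l2
        · exact h3 v hv
    · rw [List.filter_cons_of_neg (by simpa using hn), run_cons]
      have e2 := h2 c.2 (by omega)
      have l1 : fh c.1 ≤ M := by
        by_cases h : c.1 < n
        · rw [h1 _ h]; exact h3 _ h
        · rw [h2 _ (by omega)]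
      have : cx c fh = fh := by
        funext v; unfold cx
        rw [e2, min_eq_left l1, max_eq_right l1]
        split_ifs with a b
        · rw [a]
        · rw [b, e2]
        · rfl
      rw [this]
      exact ih hL' f fh h1 h2 h3

noncomputable def NetN (K n : ℕ) : List (ℕ × ℕ) := (Net K (K + 1)).filter (fun c => c.2 < n)

theorem NetN_sorted (K n : ℕ) (hn : n ≤ 2 ^ K) (f : ℕ → ℕ) (u w : ℕ) (huw : u < w) (hw : w < n) :
    run (NetN K n) f u ≤ run (NetN K n) f w := by
  set M := ∑ v ∈ Finset.range n, f v
  set fh : ℕ → ℕ := fun v => if v < n then f v else M with hfh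
  have h := run_pad n M (Net K (K + 1)) (fun c hc => (Std_Net K (K + 1) le_rfl c hc).1) f fh
    (fun v hv => by simp [hfh, hv]) (fun v hv => by simp [hfh, hv])
    (fun v hv => Finset.single_le_sum (fun _ _ => Nat.zero_le _) (Finset.mem_range.2 hv))
  unfold NetN
  rw [h u (by omega), h w hw]
  exact Net_sorted K fh u w huw (by omega)

theorem Std_NetN (K n : ℕ) : Std n (NetN K n) := by
  intro c hc
  unfold NetN at hc
  rw [List.mem_filter] at hc
  exact ⟨(Std_Net K (K + 1) le_rfl c hc.1).1, by simpa using hc.2⟩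

end SN

namespace SN

theorem flatMap_length_le {ι : Type*} (l : List ι) (F : ι → List (ℕ × ℕ)) (B : ℕ)
    (h : ∀ i ∈ l, (F i).length ≤ B) : (l.flatMap F).length ≤ l.length * B := by
  induction l with
  | nil => simp
  | cons i l ih =>
    have h1 := h i (by simp)
    have h2 := ih (fun j hj => h j (by simp [hj]))
    rw [List.flatMap_cons, List.length_append, List.length_cons, Nat.add_mul]
    omega

theorem Cl_length (b r m lam : ℕ) : (Cl b r m lam).length ≤ m * (9 * (lam + 1) * 2 ^ r) := by
  refine (flatMap_length_le _ _ (9 * (lam + 1) * 2 ^ r) ?_).trans (by simp)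
  intro i _
  rw [place_length]; exact exE_length _ _

theorem Ml_length (b r h m lam : ℕ) : (Ml b r h m lam).length ≤ m * (9 * (lam + 1) * 2 ^ r) := by
  refine (flatMap_length_le _ _ (9 * (lam + 1) * 2 ^ r) ?_).trans ?_
  · intro i _
    rw [place_length]; exact exE_length _ _
  · rw [List.length_range]; exact Nat.mul_le_mul_right _ (by omega)

theorem Cn_length (k m Lam j : ℕ) (hj : j ≤ k) :
    (Cn k m Lam j).length + m * 9 * (Lam * (j * j + 5 * j + 8) + 1) * 2 ^ (k - j) ≤
      m * 9 * (8 * Lam + 1) * 2 ^ k := by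
  induction j with
  | zero => simp [Cn]; apply le_of_eq; ring
  | succ j ih =>
    have h1 := ih (by omega)
    have h2 := Cl_length (2 ^ k) (k - 1 - j) m (Lam * ((j + 1) * (j + 2)))
    rw [Cn, List.length_append]
    have e1 : 2 ^ (k - j) = 2 * 2 ^ (k - 1 - j) := by rw [← pow_succ']; congr 1; omega
    have e2 : k - (j + 1) = k - 1 - j := by omega
    rw [e2]
    rw [e1] at h1
    have e3 : m * 9 * (Lam * (j * j + 5 * j + 8) + 1) * (2 * 2 ^ (k - 1 - j)) =
      m * (9 * (Lam * ((j + 1) * (j + 2)) + 1) * 2 ^ (k - 1 - j)) +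
      m * 9 * (Lam * ((j + 1) * (j + 1) + 5 * (j + 1) + 8) + 1) * 2 ^ (k - 1 - j) := by ring
    omega

theorem Ma_length (k m lam r : ℕ) : (Ma k m lam r).length ≤ 540 * (lam + 1) * m * 2 ^ r := by
  induction r with
  | zero => simp [Ma]
  | succ r ih =>
    rw [Ma, List.length_append, pw_length]
    have h := Nat.mul_le_mul_left 60 (Ml_length (2 ^ k) r (2 ^ (k - r)) m lam)
    have e : 540 * (lam + 1) * m * 2 ^ (r + 1) = 540 * (lam + 1) * m * 2 ^ r +
      60 * (m * (9 * (lam + 1) * 2 ^ r)) := by ring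
    omega

theorem CM_length (k m : ℕ) : (CM k m).length ≤ 5000000 * (m * 2 ^ k) := by
  unfold CM
  rw [List.length_append]
  have h1 := Cn_length k m 3840 k le_rfl
  have h2 := Ma_length k m 3840 (k + 1)
  have e1 : m * 9 * (8 * 3840 + 1) * 2 ^ k = 276489 * (m * 2 ^ k) := by ring
  have e2 : 540 * (3840 + 1) * m * 2 ^ (k + 1) = 4148280 * (m * 2 ^ k) := by ring
  omega

theorem Inn_length (b j w : ℕ) : (Inn b j w).length ≤ w * (haD * b) := by
  refine (flatMap_length_le _ _ (haD * b) ?_).trans (by simp)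
  intro i _
  rw [place_length]; exact haE_length _

theorem Sel_length (b w j : ℕ) : (Sel b w j).length ≤ w * w * (haD * b) := by
  induction w generalizing j with
  | zero => simp [Sel]
  | succ w ih =>
    rw [Sel, List.length_append]
    have h1 := Inn_length b j w
    have h2 := ih (j + 1)
    have e : (w + 1) * (w + 1) * (haD * b) = w * w * (haD * b) + w * (haD * b) +
      (w + 1) * (haD * b) := by ring
    omega

theorem Win_length (b m : ℕ) : (Win b m).length ≤ m * (400 * (haD * b)) := by
  refine (flatMap_length_le _ _ (400 * (haD * b)) ?_).trans (by simp)
  intro j _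
  refine (Sel_length b _ j).trans (Nat.mul_le_mul_right _ ?_)
  exact Nat.mul_le_mul (Nat.min_le_left 20 _) (Nat.min_le_left 20 _)

theorem Level_length (k m : ℕ) :
    (Level k m).length ≤ (400 * haD + 10000000) * (m * 2 ^ k) := by
  unfold Level mirL
  rw [List.length_append, List.length_append, List.length_map]
  have h1 := CM_length k m
  have h2 := Win_length (2 ^ k) m
  have e : (400 * haD + 10000000) * (m * 2 ^ k) = m * (400 * (haD * 2 ^ k)) +
    10000000 * (m * 2 ^ k) := by ring
  omega

theorem Net_length (K i : ℕ) (h : i ≤ K + 1) :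
    (Net K i).length ≤ i * ((400 * haD + 10000000) * 2 ^ K) := by
  induction i with
  | zero => simp [Net]
  | succ i ih =>
    rw [Net, List.length_append]
    have h1 := Level_length (K - i) (2 ^ i)
    rw [two_split K i (by omega)] at h1
    have h2 := ih (by omega)
    rw [Nat.add_mul]
    omega

theorem NetN_length (K n : ℕ) :
    (NetN K n).length ≤ (K + 1) * ((400 * haD + 10000000) * 2 ^ K) :=
  (List.length_filter_le _ _).trans (Net_length K (K + 1) le_rfl)

end SN

namespace SN

set_option linter.unusedSimpArgs false

def mkStage {V : Type*} {G : SimpleGraph V} (u v : V) (h : G.Adj u v) (d : Bool) : Stage G where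
  pairs := {(u, v)}
  adj := by intro p hp; rw [Finset.mem_singleton] at hp; subst hp; exact h
  directed := fun _ => d
  disj := by
    intro p hp q hq hpq
    rw [Finset.mem_singleton] at hp hq
    exact absurd (hp.trans hq.symm) hpq

theorem apply_single {V : Type*} [DecidableEq V] {G : SimpleGraph V} (s : Stage G) (u v : V)
    (hs : s.pairs = {(u, v)}) (f : V → ℕ) (x : V) :
    s.apply f x = if s.directed (u, v) = true then
        (if x = u then min (f u) (f v) else if x = v then max (f u) (f v) else f x)
      else (if x = u then f v else if x = v then f u else f x) := by
  have key : ∀ p, p ∈ s.pairs → p = (u, v) := by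
    intro p hp; rw [hs, Finset.mem_singleton] at hp; exact hp
  have hm : (u, v) ∈ s.pairs := by rw [hs]; simp
  unfold Stage.apply
  by_cases h1 : ∃ p, p ∈ s.pairs ∧ p.1 = x
  · have e := key _ h1.choose_spec.1
    have e' := h1.choose_spec.2
    rw [dif_pos h1, e]
    rw [e] at e'
    simp only [e'.symm, if_true]
  · have hxu : x ≠ u := fun hx => h1 ⟨(u, v), hm, hx.symm⟩
    rw [dif_neg h1]
    by_cases h2 : ∃ p, p ∈ s.pairs ∧ p.2 = x
    · have e := key _ h2.choose_spec.1
      have e' := h2.choose_spec.2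
      rw [dif_pos h2, e]
      rw [e] at e'
      simp only at e'
      subst e'
      simp [hxu]
    · have hxv : x ≠ v := fun hx => h2 ⟨(u, v), hm, hx.symm⟩
      rw [dif_neg h2]
      simp [hxu, hxv]

theorem apply_empty {V : Type*} {G : SimpleGraph V} (s : Stage G) (hs : s.pairs = ∅) (f : V → ℕ) :
    s.apply f = f := by
  funext x
  unfold Stage.apply
  rw [dif_neg (by rw [hs]; simp), dif_neg (by rw [hs]; simp)]

theorem star_adj {n : ℕ} {u v : Fin n} (hu : u.val = 0) (h : u ≠ v) : (starGraph n).Adj u v := by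
  unfold starGraph
  rw [SimpleGraph.fromRel_adj]
  exact ⟨h, Or.inl hu⟩

theorem star_adj_zero {n : ℕ} {u v : Fin n} (h : (starGraph n).Adj u v) :
    u ≠ v ∧ (u.val = 0 ∨ v.val = 0) := by
  unfold starGraph at h
  rw [SimpleGraph.fromRel_adj] at h
  exact h

theorem star_stage {n : ℕ} (s : Stage (starGraph n)) :
    ∃ τ : Equiv.Perm (Fin n), ∀ f, s.apply f = f ∨ s.apply f = f ∘ τ := by
  rcases s.pairs.eq_empty_or_nonempty with h | ⟨p, hp⟩
  · exact ⟨1, fun f => Or.inl (apply_empty s h f)⟩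
  · have hs : s.pairs = {(p.1, p.2)} := by
      ext q
      rw [Finset.mem_singleton]
      constructor
      · intro hq
        by_contra hne
        have hd := s.disj q hq p hp hne
        have h1 := star_adj_zero (s.adj p hp)
        have h2 := star_adj_zero (s.adj q hq)
        obtain ⟨d1, d2, d3, d4⟩ := hd
        rw [Ne, Fin.ext_iff] at d1 d2 d3 d4
        omega
      · rintro rfl; exact hp
    have hne : p.1 ≠ p.2 := (star_adj_zero (s.adj p hp)).1
    refine ⟨Equiv.swap p.1 p.2, fun f => ?_⟩
    have hswap : ∀ x, (f ∘ Equiv.swap p.1 p.2) x =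
        if x = p.1 then f p.2 else if x = p.2 then f p.1 else f x := by
      intro x
      simp only [Function.comp, Equiv.swap_apply_def]
      split_ifs <;> rfl
    by_cases hd : s.directed (p.1, p.2) = true
    · rcases le_total (f p.1) (f p.2) with hle | hle
      · left; funext x
        rw [apply_single s p.1 p.2 hs, if_pos hd, min_eq_left hle, max_eq_right hle]
        split_ifs with a b
        · rw [a]
        · rw [b]
        · rfl
      · right; funext x
        rw [apply_single s p.1 p.2 hs, if_pos hd, min_eq_right hle, max_eq_left hle, hswap]
    · right; funext x
      rw [apply_single s p.1 p.2 hs, if_neg hd, hswap]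

theorem run_perm {n : ℕ} (L : List (Stage (starGraph n))) :
    ∃ T : Finset (Equiv.Perm (Fin n)), T.card ≤ 2 ^ L.length ∧
      ∀ f, ∃ τ ∈ T, runNetwork L f = f ∘ τ := by
  classical
  induction L with
  | nil => exact ⟨{1}, by simp, fun f => ⟨1, by simp, rfl⟩⟩
  | cons s L ih =>
    obtain ⟨T, hT, hf⟩ := ih
    obtain ⟨σ, hσ⟩ := star_stage s
    refine ⟨T ∪ T.image (fun τ => σ * τ), ?_, fun f => ?_⟩
    · refine (Finset.card_union_le _ _).trans ?_
      have := Finset.card_image_le (s := T) (f := fun τ => σ * τ)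
      rw [List.length_cons, pow_succ]
      omega
    · have hr : runNetwork (s :: L) f = runNetwork L (s.apply f) := rfl
      obtain ⟨τ, hτ, h⟩ := hf (s.apply f)
      rw [hr, h]
      rcases hσ f with e | e
      · exact ⟨τ, Finset.mem_union_left _ hτ, by rw [e]⟩
      · exact ⟨σ * τ, Finset.mem_union_right _ (Finset.mem_image_of_mem _ hτ), by rw [e]; rfl⟩

theorem run_inj {n : ℕ} (L : List (Stage (starGraph n))) (f : Fin n → ℕ)
    (hf : Function.Injective f) : Function.Injective (runNetwork L f) := by
  obtain ⟨T, _, h⟩ := run_perm L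
  obtain ⟨τ, _, h⟩ := h f
  rw [h]
  exact hf.comp τ.injective

theorem fact_le {n N : ℕ} (π : Fin n ≃ Fin N) (L : List (Stage (starGraph n)))
    (h : IsSortingNetwork (starGraph n) π L) : n.factorial ≤ 2 ^ L.length := by
  obtain ⟨T, hT, hf⟩ := run_perm L
  refine le_trans ?_ hT
  choose τ hτ hrun using fun ρ : Equiv.Perm (Fin n) => hf (fun x => (ρ x : ℕ))
  have hcard : (Finset.univ : Finset (Equiv.Perm (Fin n))).card = n.factorial := by
    rw [Finset.card_univ, Fintype.card_perm, Fintype.card_fin]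
  rw [← hcard]
  apply Finset.card_le_card_of_injOn τ (fun ρ _ => hτ ρ)
  intro ρ₁ _ ρ₂ _ he
  have hmono : ∀ ρ : Equiv.Perm (Fin n), StrictMono (fun y : Fin N => ρ (τ ρ (π.symm y))) := by
    intro ρ a b hab
    have h1 := h (fun x => (ρ x : ℕ)) (fun a b hab => ρ.injective (Fin.ext hab)) (π.symm a) (π.symm b)
      (by simpa using hab)
    rw [hrun ρ] at h1
    exact h1
  have hsurj : ∀ ρ : Equiv.Perm (Fin n),
      Set.range (fun y : Fin N => ρ (τ ρ (π.symm y))) = Set.univ := by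
    intro ρ
    rw [Set.range_eq_univ]
    exact ρ.surjective.comp ((τ ρ).surjective.comp π.symm.surjective)
  have heq := ((hmono ρ₁).range_inj (hmono ρ₂)).1 ((hsurj ρ₁).trans (hsurj ρ₂).symm)
  ext x
  have := congrFun heq (π ((τ ρ₁).symm x))
  simp only [Equiv.symm_apply_apply, ← he, Equiv.apply_symm_apply] at this
  rw [this]

theorem runNetwork_append {V : Type*} {G : SimpleGraph V} (L M : List (Stage G)) (f : V → ℕ) :
    runNetwork (L ++ M) f = runNetwork M (runNetwork L f) := by
  simp [runNetwork, List.foldl_append]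

theorem mk_dir {n : ℕ} {u v : Fin n} (h : (starGraph n).Adj u v) (f : Fin n → ℕ) (x : Fin n) :
    (mkStage u v h true).apply f x =
      if x = u then min (f u) (f v) else if x = v then max (f u) (f v) else f x := by
  rw [apply_single _ u v rfl]
  exact if_pos rfl

theorem mk_swap {n : ℕ} {u v : Fin n} (h : (starGraph n).Adj u v) (f : Fin n → ℕ) (x : Fin n) :
    (mkStage u v h false).apply f x = if x = u then f v else if x = v then f u else f x := by
  rw [apply_single _ u v rfl]
  exact if_neg (show ¬ (false = true) by simp)

theorem sim_one {n : ℕ} (c : ℕ × ℕ) (h : c.1 < c.2) (h' : c.2 < n) :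
    ∃ S : List (Stage (starGraph n)), S.length ≤ 3 ∧ ∀ (f : Fin n → ℕ) (F : ℕ → ℕ),
      (∀ x : Fin n, f x = F x) → ∀ x : Fin n, runNetwork S f x = cx c F x := by
  obtain ⟨i, j⟩ := c
  dsimp only at h h'
  let z : Fin n := ⟨0, by omega⟩
  let vi : Fin n := ⟨i, by omega⟩
  let vj : Fin n := ⟨j, h'⟩
  have hzj : z ≠ vj := by simp only [z, vj, Ne, Fin.ext_iff]; omega
  have hij : vi ≠ vj := by simp only [vi, vj, Ne, Fin.ext_iff]; omega
  have hcx : ∀ (f : Fin n → ℕ) (F : ℕ → ℕ), (∀ x : Fin n, f x = F x) → ∀ x : Fin n,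
      cx (i, j) F x = if x = vi then min (f vi) (f vj) else
        if x = vj then max (f vi) (f vj) else f x := by
    intro f F hf x
    unfold cx
    simp only [hf, vi, vj, Fin.ext_iff]
  by_cases hi : i = 0
  · have hz : vi = z := by simp only [vi, z, Fin.ext_iff]; exact hi
    refine ⟨[mkStage z vj (star_adj rfl hzj) true], by simp, fun f F hf x => ?_⟩
    rw [hcx f F hf x, hz]
    exact mk_dir _ f x
  · have hzi : z ≠ vi := by simp only [z, vi, Ne, Fin.ext_iff]; omega
    refine ⟨[mkStage z vi (star_adj rfl hzi) false, mkStage z vj (star_adj rfl hzj) true,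
      mkStage z vi (star_adj rfl hzi) false], by simp, fun f F hf x => ?_⟩
    rw [hcx f F hf x]
    change Stage.apply _ (Stage.apply _ (Stage.apply _ f)) x = _
    simp only [mk_swap, mk_dir]
    by_cases a : x = z
    · subst a; simp [hzi, hzj, hij, hij.symm, hzi.symm, hzj.symm]
    · by_cases b : x = vi
      · subst b; simp [hzi, hzj, hij, hij.symm, hzi.symm, hzj.symm]
      · by_cases c : x = vj
        · subst c; simp [hzi, hzj, hij, hij.symm, hzi.symm, hzj.symm]
        · simp [a, b, c]

theorem sim_list {n : ℕ} (L : List (ℕ × ℕ)) (hL : Std n L) :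
    ∃ S : List (Stage (starGraph n)), S.length ≤ 3 * L.length ∧ ∀ (f : Fin n → ℕ) (F : ℕ → ℕ),
      (∀ x : Fin n, f x = F x) → ∀ x : Fin n, runNetwork S f x = run L F x := by
  induction L with
  | nil => exact ⟨[], by simp, fun f F hf x => hf x⟩
  | cons c L ih =>
    obtain ⟨S, hS, h⟩ := ih (fun d hd => hL d (by simp [hd]))
    obtain ⟨S1, hS1, h1⟩ := sim_one c (hL c (by simp)).1 (hL c (by simp)).2
    refine ⟨S1 ++ S, by simp only [List.length_append, List.length_cons]; omega, fun f F hf x => ?_⟩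
    rw [runNetwork_append, run_cons]
    exact h _ _ (h1 f F hf) x

theorem star_network (K n : ℕ) (hn : n ≤ 2 ^ K) :
    ∃ S : List (Stage (starGraph n)),
      S.length ≤ 3 * ((K + 1) * ((400 * haD + 10000000) * 2 ^ K)) ∧
      IsSortingNetwork (starGraph n) (finCongr (Fintype.card_fin n).symm) S := by
  obtain ⟨S, hS, h⟩ := sim_list (NetN K n) (Std_NetN K n)
  refine ⟨S, hS.trans (Nat.mul_le_mul_left 3 (NetN_length K n)), ?_⟩
  intro f hf u w huw
  have huw' : u.val < w.val := huw
  set F : ℕ → ℕ := fun v => if hv : v < n then f ⟨v, hv⟩ else 0 with hF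
  have hfF : ∀ x : Fin n, f x = F x := fun x => by simp [hF]
  have hle : runNetwork S f u ≤ runNetwork S f w := by
    rw [h f F hfF, h f F hfF]
    exact NetN_sorted K n hn F u w huw' w.2
  refine lt_of_le_of_ne hle (fun he => ?_)
  have := run_inj S f hf he
  omega

theorem st_le (K n : ℕ) (hn : n ≤ 2 ^ K) :
    st (starGraph n) ≤ 3 * ((K + 1) * ((400 * haD + 10000000) * 2 ^ K)) := by
  obtain ⟨S, hS, h⟩ := star_network K n hn
  refine le_trans ?_ hS
  unfold st
  apply Nat.sInf_le
  exact ⟨_, S, rfl, h⟩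

theorem st_ge (n : ℕ) : n.factorial ≤ 2 ^ st (starGraph n) := by
  have hne : {t | ∃ π : Fin n ≃ Fin (Fintype.card (Fin n)), ∃ L : List (Stage (starGraph n)),
      L.length = t ∧ IsSortingNetwork (starGraph n) π L}.Nonempty := by
    obtain ⟨S, hS, h⟩ := star_network n n Nat.lt_two_pow_self.le
    exact ⟨_, _, S, rfl, h⟩
  obtain ⟨π, L, hL, h⟩ := Nat.sInf_mem hne
  have := fact_le π L h
  rw [hL] at this
  exact this

theorem two_pow_fact (n : ℕ) : 2 ^ n ≤ (n + 1).factorial := by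
  induction n with
  | zero => simp
  | succ n ih =>
    rw [pow_succ, Nat.factorial_succ (n + 1), Nat.mul_comm]
    exact Nat.mul_le_mul (by omega) ih

end SN

/-- the sorting number of the star `K_{1,n-1}` is `Θ(n log n)`. -/
theorem stmt2 :
    (∃ C : ℝ, 0 < C ∧ ∀ n : ℕ, 2 ≤ n →
      (st (starGraph n) : ℝ) ≤ C * (n * Real.log n)) ∧
    (∃ c : ℝ, 0 < c ∧ ∀ n : ℕ, 2 ≤ n →
      c * (n * Real.log n) ≤ (st (starGraph n) : ℝ)) := by
  have hl2 := Real.log_two_gt_d9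
  have hl2' := Real.log_two_lt_d9
  constructor
  · obtain ⟨D, hD, hDpos⟩ : ∃ D : ℕ, D = 400 * SN.haD + 10000000 ∧ 0 < D :=
      ⟨400 * SN.haD + 10000000, rfl, by omega⟩
    have hst := SN.st_le
    rw [← hD] at hst
    clear hD
    refine ⟨36 * (D : ℝ), by positivity, fun n hn => ?_⟩
    have hlt : n < 2 ^ (Nat.log 2 n + 1) := Nat.lt_pow_succ_log_self (by norm_num) n
    have hle : 2 ^ Nat.log 2 n ≤ n := Nat.pow_log_le_self 2 (by omega)
    have h1 := hst (Nat.log 2 n + 1) n hlt.le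
    set q := Nat.log 2 n with hq
    have h2 : (st (starGraph n) : ℝ) ≤ 3 * (((q : ℝ) + 2) * (D * (2 * 2 ^ q))) := by
      have : (st (starGraph n) : ℝ) ≤ ((3 * ((q + 1 + 1) * (D * 2 ^ (q + 1))) : ℕ) : ℝ) := by
        exact_mod_cast h1
      refine this.trans (le_of_eq ?_)
      push_cast
      ring
    have hleR : (2 : ℝ) ^ q ≤ n := by exact_mod_cast hle
    have hlog : (q : ℝ) * Real.log 2 ≤ Real.log n := by
      rw [← Real.log_pow]
      exact Real.log_le_log (by positivity) hleR
    have hn2 : Real.log 2 ≤ Real.log n :=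
      Real.log_le_log (by norm_num) (by exact_mod_cast hn)
    have hq0 : (0 : ℝ) ≤ q := by positivity
    have h3 : (q : ℝ) + 2 ≤ 6 * Real.log n := by nlinarith
    have hlogpos : 0 ≤ Real.log n := by linarith
    calc (st (starGraph n) : ℝ) ≤ 3 * (((q : ℝ) + 2) * (D * (2 * 2 ^ q))) := h2
      _ ≤ 3 * ((6 * Real.log n) * (D * (2 * n))) := by gcongr
      _ = 36 * D * (n * Real.log n) := by ring
  · refine ⟨1 / 8, by norm_num, fun n hn => ?_⟩
    have h1 : (n.factorial : ℝ) ≤ 2 ^ st (starGraph n) := by exact_mod_cast SN.st_ge n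
    have hfpos : (0 : ℝ) < n.factorial := by exact_mod_cast n.factorial_pos
    have h2 : Real.log n.factorial ≤ st (starGraph n) * Real.log 2 := by
      rw [← Real.log_pow]; exact Real.log_le_log hfpos h1
    have ht0 : (0 : ℝ) ≤ st (starGraph n) := by positivity
    have h3 : Real.log n.factorial ≤ st (starGraph n) := by nlinarith
    refine le_trans ?_ h3
    have hnR : (2 : ℝ) ≤ n := by exact_mod_cast hn
    rcases le_or_gt 2 (Real.log n) with hl | hl
    · have h4 := Real.pow_div_factorial_le_exp (n : ℝ) (by positivity) n
      rw [div_le_iff₀ hfpos] at h4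
      have h5 := Real.log_le_log (by positivity) h4
      rw [Real.log_pow, Real.log_mul (Real.exp_ne_zero _) hfpos.ne', Real.log_exp] at h5
      nlinarith
    · obtain ⟨k, rfl⟩ : ∃ k, n = k + 1 := ⟨n - 1, by omega⟩
      have h4 : (2 : ℝ) ^ k ≤ (k + 1).factorial := by exact_mod_cast SN.two_pow_fact k
      have h5 := Real.log_le_log (by positivity) h4
      rw [Real.log_pow] at h5
      push_cast at hnR hl h5 ⊢
      nlinarith
end

section
/- Let T be a tree of diameter d and let P be a path of length d in T. Then for any k ≤ d, any set of k pebbles (located at k distinct vertices of T) can be routed into any prescribed set of k vertices of P using at most d + 2(k−1) matching steps. In particular, any d pebbles can be routed onto P in at most 3d steps. -/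
open Finset

variable {V : Type*}

/-- `t` matching steps route, for every `a ∈ A`, the pebble at `a` to `φ a`. -/
def RoutesPartialIn (G : SimpleGraph V) (A : Finset V) (φ : V → V) (t : ℕ) : Prop :=
  ∃ L : List (Equiv.Perm V), L.length = t ∧ (∀ τ ∈ L, IsMatchingStep G τ) ∧
    ∀ a ∈ A, finalPos L a = φ a

/-- `rt(G, A, B)`: the worst case over bijections `φ : A → B` of the minimal
number of matching steps routing each pebble at `a ∈ A` to `φ a`. -/
noncomputable def rtAB (G : SimpleGraph V) (A B : Finset V) : ℕ :=
  sSup {t | ∃ φ : V → V, Set.BijOn φ ↑A ↑B ∧ sInf {t' | RoutesPartialIn G A φ t'} = t}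

/-- `rt_p(G)`: the maximum of `rt(G, A, B)` over all `A, B` with `|A| = |B| ≤ p`. -/
noncomputable def rtp (G : SimpleGraph V) (p : ℕ) : ℕ :=
  sSup {t | ∃ A B : Finset V, A.card = B.card ∧ A.card ≤ p ∧ rtAB G A B = t}

/-- Exchanging the images of two tokens changes the cost only in two terms. -/
lemma sum_swap_aux {V : Type*} [DecidableEq V] (A : Finset V) (F : V → V → ℤ)
    (π : Equiv.Perm V) {a b : V} (ha : a ∈ A) (hb : b ∈ A) (hab : a ≠ b) :
    ∑ c ∈ A, F c ((π * Equiv.swap a b) c) + F a (π a) + F b (π b)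
      = ∑ c ∈ A, F c (π c) + F a (π b) + F b (π a) := by
  have hb' : b ∈ A.erase a := Finset.mem_erase.2 ⟨hab.symm, hb⟩
  rw [← Finset.add_sum_erase A _ ha, ← Finset.add_sum_erase A (fun c => F c (π c)) ha,
    ← Finset.add_sum_erase _ _ hb', ← Finset.add_sum_erase _ (fun c => F c (π c)) hb']
  have : ∑ c ∈ (A.erase a).erase b, F c ((π * Equiv.swap a b) c)
      = ∑ c ∈ (A.erase a).erase b, F c (π c) := by
    apply Finset.sum_congr rfl
    intro c hc
    simp only [Finset.mem_erase] at hc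
    rw [Equiv.Perm.mul_apply, Equiv.swap_apply_of_ne_of_ne hc.2.1 hc.1]
  rw [this]
  simp only [Equiv.Perm.mul_apply, Equiv.swap_apply_left, Equiv.swap_apply_right]
  ring

lemma swap_maps_aux {V : Type*} [DecidableEq V] {A S : Finset V}
    {π : Equiv.Perm V} (hπ : ∀ c ∈ A, π c ∈ S) {a b : V} (ha : a ∈ A) (hb : b ∈ A) :
    ∀ c ∈ A, (π * Equiv.swap a b) c ∈ S := by
  intro c hc
  rw [Equiv.Perm.mul_apply]
  by_cases h1 : c = a
  · subst h1; rw [Equiv.swap_apply_left]; exact hπ _ hb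
  by_cases h2 : c = b
  · subst h2; rw [Equiv.swap_apply_right]; exact hπ _ ha
  rw [Equiv.swap_apply_of_ne_of_ne h1 h2]; exact hπ _ hc

/-- Ranking: an injective ranking compatible with a key. -/
lemma exists_rank_aux {V : Type*} [DecidableEq V] (f : V → ℤ) (A : Finset V) :
    ∃ r : V → ℕ, Set.InjOn r A ∧ (∀ a ∈ A, r a < A.card) ∧
      ∀ a ∈ A, ∀ b ∈ A, f a < f b → r a < r b := by
  induction A using Finset.induction_on_max_value f with
  | empty => exact ⟨fun _ => 0, by simp, by simp, by simp⟩
  | insert x s hx hmax ih =>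
    obtain ⟨r, hinj, hlt, hmono⟩ := ih
    have hne : ∀ y ∈ s, y ≠ x := fun y hy h => hx (h ▸ hy)
    have hr : ∀ y ∈ s, Function.update r x s.card y = r y := fun y hy =>
      Function.update_of_ne (hne y hy) _ _
    have hrx : Function.update r x s.card x = s.card := Function.update_self _ _ _
    refine ⟨Function.update r x s.card, ?_, ?_, ?_⟩
    · intro y hy z hz hyz
      simp only [Finset.coe_insert, Set.mem_insert_iff, Finset.mem_coe] at hy hz
      rcases hy with rfl | hy <;> rcases hz with rfl | hz
      · rfl
      · rw [hrx, hr z hz] at hyz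
        have := hlt z hz; omega
      · rw [hrx, hr y hy] at hyz
        have := hlt y hy; omega
      · rw [hr y hy, hr z hz] at hyz
        exact hinj hy hz hyz
    · intro y hy
      rw [Finset.card_insert_of_notMem hx]
      rcases Finset.mem_insert.1 hy with rfl | hy
      · rw [hrx]; omega
      · rw [hr y hy]; have := hlt y hy; omega
    · intro y hy z hz hyz
      rcases Finset.mem_insert.1 hy with rfl | hy' <;>
        rcases Finset.mem_insert.1 hz with rfl | hz'
      · exact absurd hyz (lt_irrefl _)
      · exact absurd (hmax z hz') (not_le.2 hyz)
      · rw [hrx, hr y hy']; exact hlt y hy'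
      · rw [hr y hy', hr z hz']; exact hmono y hy' z hz' hyz

/-- On a tree every antisymmetric edge function has a potential. -/
lemma exists_potential_aux {V : Type*} (T : SimpleGraph V) (hT : T.IsTree)
    (sg : V → V → ℤ) (hsg : ∀ x y, sg y x = - sg x y) :
    ∃ h : V → ℤ, ∀ x y, T.Adj x y → h y - h x = sg x y := by
  classical
  obtain ⟨r⟩ := hT.connected.nonempty
  choose p hp hu using fun v => hT.existsUnique_path r v
  let W : ∀ {x y : V}, T.Walk x y → ℤ := fun w => (w.darts.map (fun d => sg d.fst d.snd)).sum
  have hW : ∀ {x y z : V} (w : T.Walk x y) (e : T.Adj y z), W (w.concat e) = W w + sg y z := by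
    intro x y z w e
    simp [W, SimpleGraph.Walk.darts_concat]
  refine ⟨fun v => W (p v), ?_⟩
  intro x y hxy
  by_cases hy : y ∈ (p x).support
  · have h1 : ((p x).takeUntil y hy).IsPath := (hp x).takeUntil hy
    have h2 := hu y _ h1
    have h3 : x ∉ (p y).support := by
      rw [← h2]
      exact SimpleGraph.Walk.endpoint_notMem_support_takeUntil (hp x) hy hxy.ne
    have h4 := hu x _ ((hp y).concat h3 hxy.symm)
    have h5 := hW (p y) hxy.symm
    rw [h4] at h5
    change W (p y) - W (p x) = sg x y
    rw [h5, hsg x y]; ring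
  · have h4 := hu y _ ((hp x).concat hy hxy)
    have h5 := hW (p x) hxy
    rw [h4] at h5
    change W (p y) - W (p x) = sg x y
    rw [h5]; ring

/-- A collection of compatible moves is realised by a matching step. -/
lemma exists_step_aux {V : Type*} (T : SimpleGraph V) (A : Finset V) (f g : V → V)
    (hadj : ∀ a ∈ A, g a ≠ f a → T.Adj (f a) (g a))
    (hf : ∀ a ∈ A, ∀ b ∈ A, f a = f b → a = b)
    (hg : ∀ a ∈ A, ∀ b ∈ A, g a ≠ f a → g b ≠ f b → g a = g b → a = b)
    (hno : ∀ a ∈ A, ∀ b ∈ A, g a ≠ f a → f b ≠ g a) :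
    ∃ σ : Equiv.Perm V, IsMatchingStep T σ ∧ ∀ a ∈ A, σ (f a) = g a := by
  classical
  let s : V → V := fun x =>
    if h1 : ∃ a, a ∈ A ∧ f a = x then g h1.choose
    else if h2 : ∃ a, a ∈ A ∧ g a ≠ f a ∧ g a = x then f h2.choose
    else x
  have s1 : ∀ a ∈ A, s (f a) = g a := by
    intro a ha
    have h1 : ∃ b, b ∈ A ∧ f b = f a := ⟨a, ha, rfl⟩
    have h3 : s (f a) = g h1.choose := dif_pos h1
    rw [h3, hf _ h1.choose_spec.1 _ ha h1.choose_spec.2]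
  have s2 : ∀ a ∈ A, g a ≠ f a → s (g a) = f a := by
    intro a ha hm
    have h1 : ¬ ∃ b, b ∈ A ∧ f b = g a := by
      rintro ⟨b, hb, h⟩
      exact hno a ha b hb hm h
    have h2 : ∃ b, b ∈ A ∧ g b ≠ f b ∧ g b = g a := ⟨a, ha, hm, rfl⟩
    have h3 : s (g a) = f h2.choose := (dif_neg h1).trans (dif_pos h2)
    rw [h3, hg _ h2.choose_spec.1 _ ha h2.choose_spec.2.1 hm h2.choose_spec.2.2]
  have s3 : ∀ x, (s x = x) ∨ (∃ a ∈ A, g a ≠ f a ∧ f a = x) ∨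
      (∃ a ∈ A, g a ≠ f a ∧ g a = x) := by
    intro x
    by_cases h1 : ∃ a, a ∈ A ∧ f a = x
    · obtain ⟨a, ha, rfl⟩ := h1
      by_cases hm : g a = f a
      · left; rw [s1 a ha, hm]
      · right; left; exact ⟨a, ha, hm, rfl⟩
    · by_cases h2 : ∃ a, a ∈ A ∧ g a ≠ f a ∧ g a = x
      · right; right; exact h2
      · left; exact (dif_neg h1).trans (dif_neg h2)
  have hinv : Function.Involutive s := by
    intro x
    rcases s3 x with h | ⟨a, ha, hm, rfl⟩ | ⟨a, ha, hm, rfl⟩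
    · rw [h, h]
    · rw [s1 a ha, s2 a ha hm]
    · rw [s2 a ha hm, s1 a ha]
  refine ⟨hinv.toPerm s, ⟨fun v => hinv v, ?_⟩, s1⟩
  intro x hx
  change s x ≠ x at hx
  change T.Adj x (s x)
  rcases s3 x with h | ⟨a, ha, hm, rfl⟩ | ⟨a, ha, hm, rfl⟩
  · exact absurd h hx
  · rw [s1 a ha]; exact hadj a ha hm
  · rw [s2 a ha hm]; exact (hadj a ha hm).symm

lemma lipschitz_walk_aux {V : Type*} (T : SimpleGraph V) (h : V → ℤ)
    (hl : ∀ x y, T.Adj x y → h y - h x ≤ 1) {x y : V} (w : T.Walk x y) :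
    h y - h x ≤ w.length := by
  induction w with
  | nil => simp
  | cons e w ih =>
    have := hl _ _ e
    rw [SimpleGraph.Walk.length_cons]; push_cast; linarith

lemma lipschitz_dist_aux {V : Type*} (T : SimpleGraph V) (hc : T.Connected) (h : V → ℤ)
    (hl : ∀ x y, T.Adj x y → h y - h x ≤ 1) (x y : V) :
    h y - h x ≤ T.dist x y := by
  obtain ⟨w, hw⟩ := hc.exists_walk_length_eq_dist x y
  rw [← hw]; exact lipschitz_walk_aux T h hl w

lemma dist_left_aux {V : Type*} (T : SimpleGraph V) {x y : V} (w : T.Walk x y) (n : ℕ) :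
    T.dist x (w.getVert n) ≤ n :=
  (SimpleGraph.dist_le (w.take n)).trans (by simp)

lemma dist_right_aux {V : Type*} (T : SimpleGraph V) {x y : V} (w : T.Walk x y) (n : ℕ) :
    T.dist (w.getVert n) y ≤ w.length - n :=
  (SimpleGraph.dist_le (w.drop n)).trans (by simp)

/-- The first stage: an assignment together with an integral Kantorovich potential. -/
lemma exists_kantorovich_aux {V : Type*} [Fintype V] [DecidableEq V] (T : SimpleGraph V)
    (hT : T.IsTree) (A S : Finset V) (hAS : A.card = S.card) :
    ∃ (h : V → ℤ) (π : Equiv.Perm V), (∀ a ∈ A, π a ∈ S) ∧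
      (∀ x y, h y - h x ≤ T.dist x y) ∧ ∀ a ∈ A, h (π a) - h a = T.dist a (π a) := by
  classical
  have hc := hT.connected
  let Q : Finset (Equiv.Perm V) := Finset.univ.filter fun π => ∀ a ∈ A, π a ∈ S
  have hQ : Q.Nonempty := by
    refine ⟨(Finset.equivOfCardEq hAS).extendSubtype, ?_⟩
    simp only [Q, Finset.mem_filter, Finset.mem_univ, true_and]
    intro a ha
    exact Equiv.extendSubtype_mem (Finset.equivOfCardEq hAS) a ha
  obtain ⟨π, hπQ, hmin⟩ := Finset.exists_min_image Q
    (fun π => ∑ c ∈ A, (T.dist c (π c) : ℤ)) hQ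
  have hπ : ∀ a ∈ A, π a ∈ S := by simpa [Q] using hπQ
  -- `U x y`: the edge from x to y is used
  let U : V → V → Prop := fun x y => ∃ a ∈ A, T.dist a (π a) = T.dist a x + 1 + T.dist y (π a)
  have hU : ∀ x y, T.Adj x y → U x y → ¬ U y x := by
    rintro x y hxy ⟨a, ha, h1⟩ ⟨b, hb, h2⟩
    by_cases hab : a = b
    · subst hab
      have e1 := hc.dist_triangle (u := a) (v := x) (w := π a)
      have e2 := hc.dist_triangle (u := a) (v := y) (w := π a)
      omega
    · have h3 := hmin (π * Equiv.swap a b) (by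
        simp only [Q, Finset.mem_filter, Finset.mem_univ, true_and]
        exact swap_maps_aux hπ ha hb)
      have h4 := sum_swap_aux A (fun c e => (T.dist c e : ℤ)) π ha hb hab
      have e1 := hc.dist_triangle (u := a) (v := x) (w := π b)
      have e2 := hc.dist_triangle (u := b) (v := y) (w := π a)
      omega
  let sg : V → V → ℤ := fun x y => if U x y ∧ ¬ U y x then 1 else if U y x ∧ ¬ U x y then -1 else 0
  have hsg : ∀ x y, sg y x = - sg x y := by
    intro x y
    by_cases h1 : U x y <;> by_cases h2 : U y x <;> simp [sg, h1, h2]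
  obtain ⟨h, hh⟩ := exists_potential_aux T hT sg hsg
  have hl : ∀ x y, T.Adj x y → h y - h x ≤ 1 := by
    intro x y hxy
    rw [hh x y hxy]
    by_cases h1 : U x y <;> by_cases h2 : U y x <;> simp [sg, h1, h2]
  refine ⟨h, π, hπ, lipschitz_dist_aux T hc h hl, ?_⟩
  intro a ha
  obtain ⟨w, hw⟩ := hc.exists_walk_length_eq_dist a (π a)
  have key : ∀ n, n ≤ w.length → h (w.getVert n) = h a + n := by
    intro n
    induction n with
    | zero => simp
    | succ n ih =>
      intro hn
      have ih := ih (by omega)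
      have hadj := w.adj_getVert_succ (i := n) (by omega)
      have hUn : U (w.getVert n) (w.getVert (n+1)) := by
        refine ⟨a, ha, ?_⟩
        have e1 := dist_left_aux T w n
        have e2 := dist_right_aux T w (n+1)
        have e3 := hc.dist_triangle (u := a) (v := w.getVert n) (w := π a)
        have e4 := hc.dist_triangle (u := w.getVert n) (v := w.getVert (n+1)) (w := π a)
        rw [SimpleGraph.dist_eq_one_iff_adj.2 hadj] at e4
        omega
      have := hh _ _ hadj
      simp only [sg, hUn, hU _ _ hadj hUn, not_false_eq_true, and_self, if_true] at this
      push_cast; linarith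
  have := key w.length le_rfl
  rw [SimpleGraph.Walk.getVert_length] at this
  rw [← hw]; linarith

/-- The second stage: additionally, uncrossed. -/
lemma exists_uncrossed_aux {V : Type*} [Fintype V] [DecidableEq V] (T : SimpleGraph V)
    (hT : T.IsTree) (A S : Finset V) (hAS : A.card = S.card) :
    ∃ (h : V → ℤ) (π : Equiv.Perm V), (∀ a ∈ A, π a ∈ S) ∧
      (∀ x y, h y - h x ≤ T.dist x y) ∧ (∀ a ∈ A, h (π a) - h a = T.dist a (π a)) ∧
      ∀ a ∈ A, ∀ b ∈ A, a ≠ b → h (π b) - h a = T.dist a (π b) →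
        h (π a) - h b = T.dist b (π a) → 0 ≤ (h b - h a) * (h (π b) - h (π a)) := by
  classical
  obtain ⟨h, π₀, hπ₀, hl, hd₀⟩ := exists_kantorovich_aux T hT A S hAS
  let Q : Finset (Equiv.Perm V) := Finset.univ.filter fun π =>
    (∀ a ∈ A, π a ∈ S) ∧ ∀ a ∈ A, h (π a) - h a = T.dist a (π a)
  obtain ⟨π, hπQ, hmax⟩ := Finset.exists_max_image Q
    (fun π => ∑ c ∈ A, h c * h (π c)) ⟨π₀, Finset.mem_filter.2 ⟨Finset.mem_univ _, hπ₀, hd₀⟩⟩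
  simp only [Q, Finset.mem_filter, Finset.mem_univ, true_and] at hπQ
  obtain ⟨hπ, hd⟩ := hπQ
  refine ⟨h, π, hπ, hl, hd, ?_⟩
  intro a ha b hb hab h1 h2
  have h3 := hmax (π * Equiv.swap a b) (by
    simp only [Q, Finset.mem_filter, Finset.mem_univ, true_and]
    refine ⟨swap_maps_aux hπ ha hb, ?_⟩
    intro c hc
    rw [Equiv.Perm.mul_apply]
    by_cases hca : c = a
    · subst hca; rw [Equiv.swap_apply_left]; exact h1
    by_cases hcb : c = b
    · subst hcb; rw [Equiv.swap_apply_right]; exact h2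
    rw [Equiv.swap_apply_of_ne_of_ne hca hcb]; exact hd c hc)
  have h4 := sum_swap_aux A (fun c e => h c * h e) π ha hb hab
  nlinarith

lemma finalPos_concat_aux {V : Type*} (L : List (Equiv.Perm V)) (σ : Equiv.Perm V) (v : V) :
    finalPos (L ++ [σ]) v = σ (finalPos L v) := by
  simp [finalPos]

/-- in a tree `T` of diameter `d` with a path `P` of length `d`,
any `k ≤ d` pebbles can be routed into any prescribed set of `k` vertices of `P`
in at most `d + 2(k-1)` matching steps (in particular, `d` pebbles can be routed
onto `P` in at most `3d` steps). -/
theorem stmt5 {V : Type*} [Fintype V] [DecidableEq V] (T : SimpleGraph V)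
    (hT : T.IsTree) (d : ℕ) (hd : T.diam = d) {u v : V} (P : T.Walk u v)
    (hP : P.IsPath) (hPlen : P.length = d) (k : ℕ) (hk : k ≤ d)
    (A : Finset V) (hA : A.card = k) (S : Finset V) (hS : S.card = k)
    (hSP : S ⊆ P.support.toFinset) :
    ∃ L : List (Equiv.Perm V), L.length ≤ d + 2 * (k - 1) ∧
      (∀ τ ∈ L, IsMatchingStep T τ) ∧ ∀ a ∈ A, finalPos L a ∈ S := by
  classical
  rcases A.eq_empty_or_nonempty with rfl | hAne
  · exact ⟨[], by simp, by simp, by simp⟩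
  have hc := hT.connected
  have hdiam : ∀ x y, T.dist x y ≤ d := by
    intro x y
    rw [← hd]
    have := hc.nonempty
    exact SimpleGraph.dist_le_diam (SimpleGraph.connected_iff_ediam_ne_top.1 hc)
  obtain ⟨h, π, hπ, hl, hgeo, hunc⟩ := exists_uncrossed_aux T hT A S (hA.trans hS.symm)
  obtain ⟨r, hrinj, hrlt, hrmono⟩ := exists_rank_aux (fun a => -(h a + h (π a))) A
  obtain ⟨c, hcA, hcmin⟩ := Finset.exists_min_image A (fun a => h a + 2 * (r a : ℤ)) hAne
  choose q hq using fun a => hc.exists_walk_length_eq_dist a (π a)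
  set m : ℤ := h c + 2 * (r c : ℤ) with hm
  -- composition of geodesics with respect to the potential
  have htrans : ∀ x y z, h y - h x = T.dist x y → h z - h y = T.dist y z →
      h z - h x = T.dist x z := by
    intro x y z h1 h2
    have h3 := hc.dist_triangle (u := x) (v := y) (w := z)
    have h4 := hl x z
    omega
  have hlen : ∀ a ∈ A, ((q a).length : ℤ) = h (π a) - h a := by
    intro a ha
    rw [hq a, hgeo a ha]
  have hvert : ∀ a ∈ A, ∀ n ≤ (q a).length, h ((q a).getVert n) = h a + n ∧
      h ((q a).getVert n) - h a = T.dist a ((q a).getVert n) ∧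
      h (π a) - h ((q a).getVert n) = T.dist ((q a).getVert n) (π a) := by
    intro a ha n hn
    have e0 := hlen a ha
    have e1 := dist_left_aux T (q a) n
    have e2 := dist_right_aux T (q a) n
    have e3 := hl a ((q a).getVert n)
    have e4 := hl ((q a).getVert n) (π a)
    omega
  let pos : ℕ → V → V := fun t a => (q a).getVert ((t : ℤ) - (h a + 2 * (r a : ℤ) - m)).toNat
  have hpos0 : ∀ a ∈ A, pos 0 a = a := by
    intro a ha
    have := hcmin a ha
    have e : (((0 : ℕ) : ℤ) - (h a + 2 * (r a : ℤ) - m)).toNat = 0 := by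
      omega
    simp only [pos, e, SimpleGraph.Walk.getVert_zero]
  -- moving tokens
  have hmove : ∀ t, ∀ a ∈ A, pos (t+1) a ≠ pos t a →
      ∃ n : ℕ, n < (q a).length ∧ (t : ℤ) = h a + 2 * (r a : ℤ) - m + n ∧
        pos t a = (q a).getVert n ∧ pos (t+1) a = (q a).getVert (n+1) := by
    intro t a ha hne
    have h1 : 0 ≤ (t : ℤ) - (h a + 2 * (r a : ℤ) - m) := by
      by_contra hneg
      apply hne
      have e1 : ((t : ℤ) - (h a + 2 * (r a : ℤ) - m)).toNat = 0 := by omega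
      have e2 : (((t + 1 : ℕ) : ℤ) - (h a + 2 * (r a : ℤ) - m)).toNat = 0 := by omega
      simp only [pos, e1, e2]
    obtain ⟨n, hn⟩ := Int.eq_ofNat_of_zero_le h1
    have e1 : ((t : ℤ) - (h a + 2 * (r a : ℤ) - m)).toNat = n := by omega
    have e2 : (((t + 1 : ℕ) : ℤ) - (h a + 2 * (r a : ℤ) - m)).toNat = n + 1 := by omega
    refine ⟨n, ?_, by omega, by simp only [pos, e1], by simp only [pos, e2]⟩
    by_contra hlt
    apply hne
    simp only [pos, e1, e2]
    rw [SimpleGraph.Walk.getVert_of_length_le _ (by omega),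
      SimpleGraph.Walk.getVert_of_length_le _ (by omega)]
  -- nobody sits on the head of a move
  have hno : ∀ t, ∀ a ∈ A, ∀ b ∈ A, pos (t+1) a ≠ pos t a → b ≠ a → pos t b ≠ pos (t+1) a := by
    intro t a ha b hb hne hba heq
    obtain ⟨n, hn, htn, -, hp1⟩ := hmove t a ha hne
    obtain ⟨v1, v2, v3⟩ := hvert a ha (n+1) hn
    rw [← hp1, ← heq] at v1 v2 v3
    push_cast at v1
    have hrne : r b ≠ r a := fun e => hba (hrinj hb ha e)
    by_cases hw : (t : ℤ) < h b + 2 * (r b : ℤ) - m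
    · -- waiting
      have e1 : ((t : ℤ) - (h b + 2 * (r b : ℤ) - m)).toNat = 0 := by omega
      have hpb : pos t b = b := by simp only [pos, e1, SimpleGraph.Walk.getVert_zero]
      rw [hpb] at v1 v2 v3
      have hu := hunc a ha b hb hba.symm (htrans _ _ _ v2 (hgeo b hb)) v3
      have hpos : 0 < h b - h a := by omega
      have h5 : 0 ≤ h (π b) - h (π a) := nonneg_of_mul_nonneg_right hu hpos
      have := hrmono b hb a ha (by omega)
      omega
    · obtain ⟨n', hn'⟩ := Int.eq_ofNat_of_zero_le (show 0 ≤ (t : ℤ) - (h b + 2 * (r b : ℤ) - m) by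
        omega)
      have e1 : ((t : ℤ) - (h b + 2 * (r b : ℤ) - m)).toNat = n' := by omega
      have hpb : pos t b = (q b).getVert n' := by simp only [pos, e1]
      by_cases hf : n' < (q b).length
      · obtain ⟨w1, -, -⟩ := hvert b hb n' hf.le
        rw [← hpb] at w1
        omega
      · have hpb' : pos t b = π b := by
          rw [hpb, SimpleGraph.Walk.getVert_of_length_le _ (by omega)]
        rw [hpb'] at v1 v2 v3
        have hu := hunc b hb a ha hba (htrans _ _ _ (hgeo b hb) v3) v2
        have hdpos : 0 < T.dist (π b) (π a) := by
          rw [Nat.pos_iff_ne_zero, Ne, hc.dist_eq_zero_iff]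
          exact fun e => hba (π.injective e)
        have hpos : 0 < h (π a) - h (π b) := by omega
        have h5 : 0 ≤ h a - h b := nonneg_of_mul_nonneg_left hu hpos
        have h6 := hrmono a ha b hb (by omega)
        have h7 := hlen b hb
        omega
  have main : ∀ N : ℕ, ∃ L : List (Equiv.Perm V), L.length = N ∧
      (∀ τ ∈ L, IsMatchingStep T τ) ∧ ∀ a ∈ A, finalPos L a = pos N a := by
    intro N
    induction N with
    | zero => exact ⟨[], rfl, by simp, fun a ha => (hpos0 a ha).symm⟩
    | succ t ih =>
      obtain ⟨L, hL, hLm, hLp⟩ := ih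
      have hinjL : ∀ (L : List (Equiv.Perm V)) (x y : V), finalPos L x = finalPos L y → x = y := by
        intro L
        induction L with
        | nil => intro x y h; exact h
        | cons σ L ih => intro x y h; exact σ.injective (ih _ _ h)
      obtain ⟨σ, hσ, hσp⟩ := exists_step_aux T A (pos t) (pos (t+1))
        (by
          intro a ha hne
          obtain ⟨n, hn, -, e1, e2⟩ := hmove t a ha hne
          rw [e1, e2]
          exact (q a).adj_getVert_succ hn)
        (by
          intro a ha b hb hab
          rw [← hLp a ha, ← hLp b hb] at hab
          exact hinjL L a b hab)
        (by
          intro a ha b hb hma hmb hab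
          obtain ⟨n, hn, e0, -, e2⟩ := hmove t a ha hma
          obtain ⟨n', hn', e0', -, e2'⟩ := hmove t b hb hmb
          obtain ⟨v1, -, -⟩ := hvert a ha (n+1) hn
          obtain ⟨w1, -, -⟩ := hvert b hb (n'+1) hn'
          rw [← e2, hab] at v1
          rw [← e2'] at w1
          apply hrinj ha hb
          push_cast at v1 w1
          omega)
        (by
          intro a ha b hb hma
          by_cases hba : b = a
          · subst hba; exact hma.symm
          · exact hno t a ha b hb hma hba)
      refine ⟨L ++ [σ], by simp [hL], ?_, ?_⟩
      · intro τ hτ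
        rcases List.mem_append.1 hτ with h1 | h1
        · exact hLm τ h1
        · rw [List.mem_singleton.1 h1]; exact hσ
      · intro a ha
        rw [finalPos_concat_aux, hLp a ha, hσp a ha]
  obtain ⟨L, hL, hLm, hLp⟩ := main (d + 2 * (k - 1))
  refine ⟨L, hL.le, hLm, ?_⟩
  intro a ha
  have hend : pos (d + 2 * (k - 1)) a = π a := by
    simp only [pos]
    apply SimpleGraph.Walk.getVert_of_length_le
    have h1 := hlen a ha
    have h2 := hl c (π a)
    have h3 := hdiam c (π a)
    have h4 := hrlt a ha
    omega
  rw [hLp a ha, hend]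
  exact hπ a ha
end
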